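/- arXiv:1711.09036 — 4 statements merged into one kernel-verified Lean document; each statement's English description precedes it below -/
import Mathlib

section
/- Assume λ > 0, v₀ ∈ ℝ, and μ is a nonnegative measurable function satisfying (aa) and (f1). Then the unique absolutely continuous solution of (k * v′)(t) + λ v(t) = 0 (a.e. t > 0), v(0) = v₀, is given by the explicit formula v(t) = v₀ (λ/π) ∫₀^∞ (e^{−rt}/r) · (∫₀¹ r^α sin(πα) μ(α) dα) / [ (λ + ∫₀¹ r^α cos(πα) μ(α) dα)² + (∫₀¹ r^α sin(πα) μ(α) dα)² ] dr. -/
open MeasureTheory Set Real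

/-- The kernel `k(t) = ∫₀¹ t^{-α} μ(α)/Γ(1-α) dα`. -/
noncomputable def kker (μ : ℝ → ℝ) (t : ℝ) : ℝ :=
  ∫ α in Ioo (0:ℝ) 1, t ^ (-α) * μ α / Real.Gamma (1 - α)

/-- The function `G(r)` from formula (g1). -/
noncomputable def Gfun (μ : ℝ → ℝ) (lam : ℝ) (r : ℝ) : ℝ :=
  (∫ α in Ioo (0:ℝ) 1, r ^ α * Real.sin (π * α) * μ α) /
    ((lam + ∫ α in Ioo (0:ℝ) 1, r ^ α * Real.cos (π * α) * μ α) ^ 2 +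
      (∫ α in Ioo (0:ℝ) 1, r ^ α * Real.sin (π * α) * μ α) ^ 2)

/-- The function `v` from formula (postacv). -/
noncomputable def vfun (μ : ℝ → ℝ) (lam v₀ : ℝ) (t : ℝ) : ℝ :=
  v₀ * (lam / π) * ∫ r in Ioi (0:ℝ), (Real.exp (-r * t) / r) * Gfun μ lam r

section DistributedOrder

open ProbabilityTheory Filter Topology

/-- Points of the closed strip `0 ≤ im w ≤ π` whose real part tends along `l`. -/
def stripEnd (l : Filter ℝ) : Filter ℂ :=
  comap Complex.re l ⊓ 𝓟 {w | w.im ∈ Icc 0 π}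

lemma tendsto_intervalIntegral_of_tendsto_stripEnd {φ : ℂ → ℂ} {l : Filter ℝ}
    [l.IsCountablyGenerated] {a : ℂ}
    (hd : ∀ w : ℂ, w.im ∈ Icc 0 π → DifferentiableAt ℂ φ w)
    (h : Tendsto φ (stripEnd l) (𝓝 a)) :
    Tendsto (fun R : ℝ => ∫ y in (0:ℝ)..π, φ (R + y * Complex.I)) l (𝓝 (π * a)) := by
  have hca : (π * a : ℂ) = ∫ _ in (0:ℝ)..π, a := by simp
  rw [hca]
  have hmap : ∀ y ∈ Icc (0:ℝ) π,
      Tendsto (fun R : ℝ => (R + y * Complex.I : ℂ)) l (stripEnd l) := by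
    intro y hy
    refine tendsto_inf.2 ⟨tendsto_comap_iff.2 ?_, tendsto_principal.2 ?_⟩
    · have : Complex.re ∘ (fun R : ℝ => (R + y * Complex.I : ℂ)) = id := by ext; simp
      rw [this]; exact tendsto_id
    · exact Eventually.of_forall fun R => by simpa using hy
  refine intervalIntegral.tendsto_integral_filter_of_dominated_convergence
    (fun _ => ‖a‖ + 1) (Eventually.of_forall fun R => ?_) ?_ (by simp) ?_
  · refine ContinuousOn.aestronglyMeasurable (fun y hy => ?_) measurableSet_uIoc
    have hy' : y ∈ Icc (0:ℝ) π := by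
      rw [uIoc_of_le pi_pos.le] at hy; exact Ioc_subset_Icc_self hy
    have := (hd (R + y * Complex.I) (by simpa using hy')).continuousAt
    exact (ContinuousAt.comp (f := fun y : ℝ => (R + y * Complex.I : ℂ)) this
      (by fun_prop)).continuousWithinAt
  · have h1 : ∀ᶠ w in stripEnd l, ‖φ w‖ < ‖a‖ + 1 :=
      h.norm.eventually (gt_mem_nhds (by linarith))
    rw [stripEnd, eventually_inf_principal, eventually_comap] at h1
    filter_upwards [h1] with R hR
    refine Eventually.of_forall fun y hy => ?_
    have hy' : y ∈ Icc (0:ℝ) π := by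
      rw [uIoc_of_le pi_pos.le] at hy; exact Ioc_subset_Icc_self hy
    exact (hR (R + y * Complex.I) (by simp) (by simpa using hy')).le
  · refine Eventually.of_forall fun y hy => ?_
    have hy' : y ∈ Icc (0:ℝ) π := by
      rw [uIoc_of_le pi_pos.le] at hy; exact Ioc_subset_Icc_self hy
    exact h.comp (hmap y hy')

lemma strip_integral {φ : ℂ → ℂ} {a b : ℂ}
    (hd : ∀ w : ℂ, w.im ∈ Icc 0 π → DifferentiableAt ℂ φ w)
    (hreal : ∀ x : ℝ, (φ x).im = 0)
    (hnonpos : ∀ x : ℝ, (φ (x + π * Complex.I)).im ≤ 0)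
    (htop : Tendsto φ (stripEnd atTop) (𝓝 a))
    (hbot : Tendsto φ (stripEnd atBot) (𝓝 b)) :
    Integrable (fun x : ℝ => -(φ (x + π * Complex.I)).im) ∧
      ∫ x : ℝ, -(φ (x + π * Complex.I)).im = π * (b.re - a.re) := by
  have hcont : Continuous fun x : ℝ => φ (x + π * Complex.I) := by
    rw [continuous_iff_continuousAt]
    intro x
    have := (hd (x + π * Complex.I) (by simp [pi_pos.le])).continuousAt
    exact ContinuousAt.comp (f := fun x : ℝ => (x + π * Complex.I : ℂ)) this (by fun_prop)
  have hcont0 : Continuous fun x : ℝ => φ x := by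
    rw [continuous_iff_continuousAt]
    intro x
    have := (hd x (by simp [pi_pos.le])).continuousAt
    exact ContinuousAt.comp (f := fun x : ℝ => (x : ℂ)) this (by fun_prop)
  have key : ∀ R : ℝ, 0 < R → ∫ x in Ioc (-R) R, -(φ (x + π * Complex.I)).im =
      (∫ y in (0:ℝ)..π, φ ((-R : ℝ) + y * Complex.I)).re -
        (∫ y in (0:ℝ)..π, φ (R + y * Complex.I)).re := by
    intro R hR
    have h := Complex.integral_boundary_rect_eq_zero_of_differentiableOn φ
      ((-R : ℝ) : ℂ) (R + π * Complex.I) (by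
        intro w hw
        refine (hd w ?_).differentiableWithinAt
        have := hw.2
        simpa [uIcc_of_le pi_pos.le] using this)
    have h2 := congrArg Complex.im h
    simp only [Complex.ofReal_re, Complex.ofReal_im, Complex.add_re, Complex.add_im,
      Complex.mul_re, Complex.mul_im, Complex.I_re, Complex.I_im, mul_zero, mul_one, zero_mul,
      add_zero, zero_add, Complex.ofReal_zero, Complex.sub_im, smul_eq_mul,
      Complex.zero_im, one_mul, sub_self] at h2
    have e1 : (∫ x in (-R)..R, φ (x:ℂ)).im = 0 := by
      have : (∫ x in (-R)..R, φ (x:ℂ)).im = ∫ x in (-R)..R, (φ (x:ℂ)).im :=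
        (Complex.imCLM.intervalIntegral_comp_comm (hcont0.intervalIntegrable _ _)).symm
      rw [this]; simp [hreal]
    have e2 : (∫ x in (-R)..R, φ (x + π * Complex.I)).im =
        ∫ x in (-R)..R, (φ (x + π * Complex.I)).im :=
      (Complex.imCLM.intervalIntegral_comp_comm (hcont.intervalIntegrable _ _)).symm
    rw [← intervalIntegral.integral_of_le (by linarith), intervalIntegral.integral_neg, ← e2]
    rw [e1] at h2
    linarith
  have hlim : Tendsto (fun R : ℝ => ∫ x in Ioc (-R) R, -(φ (x + π * Complex.I)).im) atTop
      (𝓝 (π * (b.re - a.re))) := by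
    have h1 := tendsto_intervalIntegral_of_tendsto_stripEnd hd htop
    have h2 := (tendsto_intervalIntegral_of_tendsto_stripEnd hd hbot).comp tendsto_neg_atTop_atBot
    have h3 := ((Complex.continuous_re.tendsto _).comp h2).sub
      ((Complex.continuous_re.tendsto _).comp h1)
    have : π * (b.re - a.re) = (π * b : ℂ).re - (π * a : ℂ).re := by simp; ring
    rw [this]
    refine h3.congr' ?_
    filter_upwards [eventually_gt_atTop 0] with R hR
    rw [key R hR]
    rfl
  have hcov : AECover (volume : Measure ℝ) atTop fun R : ℝ => Ioc (-R) R :=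
    aecover_Ioc tendsto_neg_atTop_atBot tendsto_id
  have hcontim : Continuous fun x : ℝ => -(φ (x + π * Complex.I)).im :=
    (Complex.continuous_im.comp hcont).neg
  have hi : ∀ R : ℝ, IntegrableOn (fun x : ℝ => -(φ (x + π * Complex.I)).im) (Ioc (-R) R) :=
    fun R => (hcontim.integrableOn_Icc).mono_set Ioc_subset_Icc_self
  have hn : ∀ᵐ x : ℝ, 0 ≤ -(φ (x + π * Complex.I)).im :=
    Eventually.of_forall fun x => by linarith [hnonpos x]
  exact ⟨hcov.integrable_of_integral_tendsto_of_nonneg_ae _ hi hn hlim,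
    hcov.integral_eq_of_tendsto_of_nonneg_ae _ hn hi hlim⟩

/-- Finite measures with the same finite Laplace transform on a half line agree. -/
lemma ext_of_lintegral_exp {m n : Measure ℝ} [IsFiniteMeasure m] [IsFiniteMeasure n]
    (hfin : ∀ s < 1, ∫⁻ x, ENNReal.ofReal (exp (s * x)) ∂m ≠ ⊤)
    (h : ∀ s < 1, ∫⁻ x, ENNReal.ofReal (exp (s * x)) ∂m = ∫⁻ x, ENNReal.ofReal (exp (s * x)) ∂n) :
    m = n := by
  have hint : ∀ (m : Measure ℝ), (∀ s < 1, ∫⁻ x, ENNReal.ofReal (exp (s * x)) ∂m ≠ ⊤) →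
      Iio 1 ⊆ interior (integrableExpSet id m) := by
    intro m hm
    refine interior_maximal (fun s hs => ?_) isOpen_Iio
    refine ⟨by fun_prop, ?_⟩
    rw [hasFiniteIntegral_iff_ofReal (ae_of_all _ fun x => (exp_pos _).le)]
    exact (hm s hs).lt_top
  have hm := hint m hfin
  have hn := hint n fun s hs => h s hs ▸ hfin s hs
  have hopen : IsPreconnected {z : ℂ | z.re < 1} := (convex_halfSpace_re_lt 1).isPreconnected
  have hAm : AnalyticOnNhd ℂ (complexMGF id m) {z | z.re < 1} :=
    analyticOnNhd_complexMGF.mono fun z hz => hm hz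
  have hAn : AnalyticOnNhd ℂ (complexMGF id n) {z | z.re < 1} :=
    analyticOnNhd_complexMGF.mono fun z hz => hn hz
  have hreal : ∀ s : ℝ, s < 1 → complexMGF id m s = complexMGF id n s := by
    intro s hs
    rw [complexMGF_ofReal, complexMGF_ofReal]
    simp only [mgf, id]
    rw [integral_eq_lintegral_of_nonneg_ae (ae_of_all _ fun x => (exp_pos _).le) (by fun_prop),
      integral_eq_lintegral_of_nonneg_ae (ae_of_all _ fun x => (exp_pos _).le) (by fun_prop), h s hs]
  have heq : EqOn (complexMGF id m) (complexMGF id n) {z | z.re < 1} := by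
    refine hAm.eqOn_of_preconnected_of_frequently_eq hAn hopen (z₀ := 0) (by simp) ?_
    have ht : Filter.Tendsto (fun x : ℝ => (x : ℂ)) (nhdsWithin 0 {0}ᶜ) (nhdsWithin 0 {0}ᶜ) := by
      refine tendsto_nhdsWithin_iff.2 ⟨?_, ?_⟩
      · have : Filter.Tendsto (fun x : ℝ => (x : ℂ)) (nhds 0) (nhds ((0 : ℝ) : ℂ)) :=
          Complex.continuous_ofReal.tendsto 0
        simpa using this.mono_left nhdsWithin_le_nhds
      · filter_upwards [self_mem_nhdsWithin] with x hx
        simpa using hx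
    refine ht.frequently (Filter.Eventually.frequently ?_)
    have : ∀ᶠ x : ℝ in nhds 0, x < 1 := gt_mem_nhds one_pos
    exact (this.filter_mono nhdsWithin_le_nhds).mono fun x hx => hreal x hx
  refine Measure.ext_of_charFun (funext fun t => ?_)
  rw [← complexMGF_id_mul_I, ← complexMGF_id_mul_I]
  exact heq (by simp)

/-- The moment `∫ e^{xα} sin(πα) dν(α)`. -/
noncomputable def sinMoment (ν : Measure ℝ) (x : ℝ) : ℝ := ∫ α, exp (x * α) * sin (π * α) ∂ν

section UnitSupport

variable {ν : Measure ℝ} [IsFiniteMeasure ν]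

lemma integrable_exp_of_unit (hν : ∀ᵐ α ∂ν, α ∈ Ioo (0:ℝ) 1) (x : ℝ) :
    Integrable (fun α => exp (x * α)) ν := by
  refine Integrable.of_bound (by fun_prop) (exp |x|) ?_
  filter_upwards [hν] with α hα
  rw [norm_of_nonneg (exp_pos _).le, exp_le_exp]
  calc x * α ≤ |x| * α := by gcongr; exacts [hα.1.le, le_abs_self x]
    _ ≤ |x| * 1 := by gcongr; exact hα.2.le
    _ = |x| := mul_one _

lemma integrable_exp_mul_of_unit (hν : ∀ᵐ α ∂ν, α ∈ Ioo (0:ℝ) 1) (x : ℝ) {f : ℝ → ℝ}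
    (hf : Continuous f) (hb : ∀ α, |f α| ≤ 1) :
    Integrable (fun α => exp (x * α) * f α) ν :=
  (integrable_exp_of_unit hν x).mul_bdd (c := 1) hf.aestronglyMeasurable (ae_of_all _ hb)

lemma integrable_cexp_of_unit (hν : ∀ᵐ α ∂ν, α ∈ Ioo (0:ℝ) 1) (w : ℂ) :
    Integrable (fun α : ℝ => Complex.exp (w * α)) ν := by
  refine (integrable_exp_of_unit hν w.re).mono' (by fun_prop) (ae_of_all _ fun α => ?_)
  simp [Complex.norm_exp]

lemma differentiable_complexMGF_of_unit (hν : ∀ᵐ α ∂ν, α ∈ Ioo (0:ℝ) 1) :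
    Differentiable ℂ (complexMGF id ν) := by
  intro w
  have : integrableExpSet id ν = univ := eq_univ_of_forall fun x => integrable_exp_of_unit hν x
  exact (hasDerivAt_complexMGF (by simp [this])).differentiableAt

lemma sin_pi_mul_pos {α : ℝ} (hα : α ∈ Ioo (0:ℝ) 1) : 0 < sin (π * α) :=
  sin_pos_of_pos_of_lt_pi (mul_pos pi_pos hα.1) (by nlinarith [pi_pos, hα.2])

lemma sin_pi_mul_le_cos {α y : ℝ} (hα : α ∈ Ioo (0:ℝ) 1) (hy : y ∈ Icc 0 π) :
    sin (π * α) ≤ cos (α * y - y / 2) := by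
  have h1 : sin (π * α) = cos |(α - 1 / 2) * π| := by
    rw [cos_abs, ← cos_pi_div_two_sub, ← cos_neg]; congr 1; ring
  have h2 : cos (α * y - y / 2) = cos |(α - 1 / 2) * y| := by rw [cos_abs]; congr 1; ring
  have h3 : |α - 1 / 2| ≤ 1 / 2 := by rw [abs_le]; constructor <;> linarith [hα.1, hα.2]
  rw [h1, h2]
  apply cos_le_cos_of_nonneg_of_le_pi (abs_nonneg _)
  · rw [abs_mul, abs_of_pos pi_pos]; nlinarith [pi_pos]
  · rw [abs_mul, abs_mul, abs_of_pos pi_pos, abs_of_nonneg hy.1]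
    gcongr; exact hy.2

lemma sinMoment_le_norm (hν : ∀ᵐ α ∂ν, α ∈ Ioo (0:ℝ) 1) {c : ℝ} (hc : 0 ≤ c) {w : ℂ}
    (hw : w.im ∈ Icc 0 π) : sinMoment ν w.re ≤ ‖(c : ℂ) + complexMGF id ν w‖ := by
  set u : ℂ := Complex.exp (-(w.im / 2 : ℝ) * Complex.I) with hu
  have hnu : ‖u‖ = 1 := by
    rw [hu, ← Complex.ofReal_neg]; exact Complex.norm_exp_ofReal_mul_I _
  have hre : (((c : ℂ) + complexMGF id ν w) * u).re =
      c * cos (w.im / 2) + ∫ α, exp (w.re * α) * cos (α * w.im - w.im / 2) ∂ν := by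
    rw [add_mul, Complex.add_re]
    congr 1
    · simp [hu, Complex.exp_re]
    · rw [complexMGF, ← integral_mul_const]
      have := integral_re (𝕜 := ℂ) ((integrable_cexp_of_unit hν w).mul_const u)
      simp only [RCLike.re_eq_complex_re] at this
      simp only [id]
      rw [← this]
      refine integral_congr_ae (ae_of_all _ fun α => ?_)
      simp only [hu]
      rw [← Complex.exp_add, Complex.exp_re]
      simp
      congr 1; ring
  calc sinMoment ν w.re ≤ ∫ α, exp (w.re * α) * cos (α * w.im - w.im / 2) ∂ν := by
        refine integral_mono_ae
          (integrable_exp_mul_of_unit hν _ (by fun_prop) fun α => abs_sin_le_one _)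
          (integrable_exp_mul_of_unit hν _ (by fun_prop) fun α => abs_cos_le_one _) ?_
        filter_upwards [hν] with α hα
        gcongr
        exact sin_pi_mul_le_cos hα hw
    _ ≤ (((c : ℂ) + complexMGF id ν w) * u).re := by
        rw [hre]
        have : 0 ≤ cos (w.im / 2) := cos_nonneg_of_neg_pi_div_two_le_of_le
          (by linarith [hw.1, pi_pos]) (by linarith [hw.2])
        have := mul_nonneg hc this
        linarith
    _ ≤ ‖((c : ℂ) + complexMGF id ν w) * u‖ := Complex.re_le_norm _
    _ = _ := by rw [norm_mul, hnu, mul_one]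

lemma sinMoment_pos (hν : ∀ᵐ α ∂ν, α ∈ Ioo (0:ℝ) 1) (h0 : ν ≠ 0) (x : ℝ) :
    0 < sinMoment ν x := by
  have hp : ∀ᵐ α ∂ν, 0 < exp (x * α) * sin (π * α) := by
    filter_upwards [hν] with α hα using mul_pos (exp_pos _) (sin_pi_mul_pos hα)
  refine (integral_pos_iff_support_of_nonneg_ae (hp.mono fun _ h => h.le)
    (integrable_exp_mul_of_unit hν _ (by fun_prop) fun α => abs_sin_le_one _)).2 ?_
  rw [pos_iff_ne_zero]
  intro h
  apply h0
  have h2 : ∀ᵐ α ∂ν, α ∉ Function.support fun α => exp (x * α) * sin (π * α) :=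
    measure_eq_zero_iff_ae_notMem.1 h
  have : ∀ᵐ α ∂ν, False := by
    filter_upwards [hp, h2] with α h3 h4 using h4 h3.ne'
  simpa using this

lemma exists_sinMoment_ge (hν : ∀ᵐ α ∂ν, α ∈ Ioo (0:ℝ) 1) (h0 : ν ≠ 0) :
    ∃ c > 0, ∀ x, c * x ≤ sinMoment ν x := by
  have hp : ∀ᵐ α ∂ν, 0 < α * sin (π * α) := by
    filter_upwards [hν] with α hα using mul_pos hα.1 (sin_pi_mul_pos hα)
  have hi : Integrable (fun α => α * sin (π * α)) ν := by
    refine Integrable.of_bound (by fun_prop) 1 ?_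
    filter_upwards [hν] with α hα
    rw [norm_mul, norm_of_nonneg hα.1.le]
    exact mul_le_one₀ hα.2.le (norm_nonneg _) (abs_sin_le_one _)
  refine ⟨∫ α, α * sin (π * α) ∂ν, ?_, fun x => ?_⟩
  · refine (integral_pos_iff_support_of_nonneg_ae (hp.mono fun _ h => h.le) hi).2 ?_
    rw [pos_iff_ne_zero]
    intro h
    apply h0
    have h2 : ∀ᵐ α ∂ν, α ∉ Function.support fun α => α * sin (π * α) :=
      measure_eq_zero_iff_ae_notMem.1 h
    have : ∀ᵐ α ∂ν, False := by
      filter_upwards [hp, h2] with α h3 h4 using h4 h3.ne'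
    simpa using this
  · rw [← integral_mul_const]
    refine integral_mono_ae (hi.mul_const x)
      (integrable_exp_mul_of_unit hν _ (by fun_prop) fun α => abs_sin_le_one _) ?_
    filter_upwards [hν] with α hα
    have h1 := sin_pi_mul_pos hα
    have h2 : x * α ≤ exp (x * α) := by linarith [add_one_le_exp (x * α)]
    nlinarith

lemma add_complexMGF_ne_zero (hν : ∀ᵐ α ∂ν, α ∈ Ioo (0:ℝ) 1) (h0 : ν ≠ 0) {c : ℝ} (hc : 0 ≤ c)
    {w : ℂ} (hw : w.im ∈ Icc 0 π) : (c : ℂ) + complexMGF id ν w ≠ 0 :=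
  norm_pos_iff.1 ((sinMoment_pos hν h0 _).trans_le (sinMoment_le_norm hν hc hw))

lemma tendsto_inv_add_complexMGF_atTop (hν : ∀ᵐ α ∂ν, α ∈ Ioo (0:ℝ) 1) (h0 : ν ≠ 0) {c : ℝ}
    (hc : 0 ≤ c) :
    Tendsto (fun w => ((c : ℂ) + complexMGF id ν w)⁻¹) (stripEnd atTop) (𝓝 0) := by
  obtain ⟨d, hd, hle⟩ := exists_sinMoment_ge hν h0
  refine tendsto_inv₀_cobounded.comp (tendsto_norm_atTop_iff_cobounded.1 ?_)
  have hre : Tendsto Complex.re (stripEnd atTop) atTop := tendsto_comap.mono_left inf_le_left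
  refine tendsto_atTop_mono' _ ?_ (hre.const_mul_atTop hd)
  filter_upwards [mem_inf_of_right (mem_principal_self _)] with w hw
  exact (hle _).trans (sinMoment_le_norm hν hc hw)

lemma tendsto_mgf_atBot (hν : ∀ᵐ α ∂ν, α ∈ Ioo (0:ℝ) 1) :
    Tendsto (mgf id ν) atBot (𝓝 0) := by
  have : (0:ℝ) = ∫ α, 0 ∂ν := by simp
  rw [this]
  refine tendsto_integral_filter_of_dominated_convergence (fun _ => 1)
    (Eventually.of_forall fun x => by fun_prop) ?_ (integrable_const _) ?_
  · filter_upwards [eventually_le_atBot 0] with x hx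
    filter_upwards [hν] with α hα
    rw [norm_of_nonneg (exp_pos _).le, exp_le_one_iff]
    exact mul_nonpos_of_nonpos_of_nonneg hx hα.1.le
  · filter_upwards [hν] with α hα
    exact tendsto_exp_atBot.comp (tendsto_id.atBot_mul_const hα.1)

lemma tendsto_inv_add_complexMGF_atBot (hν : ∀ᵐ α ∂ν, α ∈ Ioo (0:ℝ) 1) {c : ℝ} (hc : 0 < c) :
    Tendsto (fun w => ((c : ℂ) + complexMGF id ν w)⁻¹) (stripEnd atBot) (𝓝 (c : ℂ)⁻¹) := by
  have hre : Tendsto Complex.re (stripEnd atBot) atBot := tendsto_comap.mono_left inf_le_left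
  have h1 : Tendsto (complexMGF id ν) (stripEnd atBot) (𝓝 0) := by
    refine squeeze_zero_norm (fun w => norm_complexMGF_le_mgf) ?_
    exact (tendsto_mgf_atBot hν).comp hre
  have := (h1.const_add (c : ℂ)).inv₀ (by simpa using hc.ne')
  simpa using this

/-- The jump density `-Im 1/(c + ∫ (e^x e^{iπ})^α dν)`. -/
noncomputable def jump (ν : Measure ℝ) (c x : ℝ) : ℝ :=
  -(((c : ℂ) + complexMGF id ν (x + π * Complex.I))⁻¹).im

lemma complexMGF_pi (hν : ∀ᵐ α ∂ν, α ∈ Ioo (0:ℝ) 1) (x : ℝ) :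
    (complexMGF id ν (x + π * Complex.I)).im = sinMoment ν x ∧
    (complexMGF id ν (x + π * Complex.I)).re = ∫ α, exp (x * α) * cos (π * α) ∂ν := by
  have hi := integrable_cexp_of_unit hν (x + π * Complex.I)
  have h1 := integral_im (𝕜 := ℂ) hi
  have h2 := integral_re (𝕜 := ℂ) hi
  simp only [RCLike.re_eq_complex_re, RCLike.im_eq_complex_im] at h1 h2
  simp only [complexMGF, id]
  rw [← h1, ← h2]
  constructor
  · refine integral_congr_ae (ae_of_all _ fun α => ?_)
    simp [Complex.exp_im]
  · refine integral_congr_ae (ae_of_all _ fun α => ?_)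
    simp [Complex.exp_re]

lemma jump_eq (hν : ∀ᵐ α ∂ν, α ∈ Ioo (0:ℝ) 1) (c x : ℝ) :
    jump ν c x = sinMoment ν x /
      ((c + ∫ α, exp (x * α) * cos (π * α) ∂ν) ^ 2 + sinMoment ν x ^ 2) := by
  obtain ⟨h1, h2⟩ := complexMGF_pi hν x
  rw [jump, Complex.inv_im, Complex.normSq_apply]
  simp only [Complex.add_re, Complex.add_im, Complex.ofReal_re, Complex.ofReal_im, h1, h2]
  ring

lemma jump_nonneg (hν : ∀ᵐ α ∂ν, α ∈ Ioo (0:ℝ) 1) (h0 : ν ≠ 0) (c x : ℝ) : 0 ≤ jump ν c x := by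
  rw [jump_eq hν]
  have := sinMoment_pos hν h0 x
  positivity

lemma integral_jump (hν : ∀ᵐ α ∂ν, α ∈ Ioo (0:ℝ) 1) (h0 : ν ≠ 0) {c : ℝ} (hc : 0 < c) :
    Integrable (jump ν c) ∧ ∫ x, jump ν c x = π / c := by
  have hdB := differentiable_complexMGF_of_unit hν
  have := strip_integral (φ := fun w => ((c : ℂ) + complexMGF id ν w)⁻¹)
    (fun w hw => ((hdB w).const_add _).inv (add_complexMGF_ne_zero hν h0 hc.le hw))
    (fun x => by rw [complexMGF_ofReal, ← Complex.ofReal_add, ← Complex.ofReal_inv]; simp)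
    (fun x => by have := jump_nonneg hν h0 c x; rw [jump] at this; linarith)
    (tendsto_inv_add_complexMGF_atTop hν h0 hc.le) (tendsto_inv_add_complexMGF_atBot hν hc)
  refine ⟨this.1, this.2.trans ?_⟩
  rw [← Complex.ofReal_inv, Complex.ofReal_re, Complex.zero_re, sub_zero, div_eq_mul_inv]

lemma exp_eq_exp_of_strip {w : ℂ} {q : ℝ} (hw : w.im ∈ Icc 0 π)
    (h : Complex.exp w = Complex.exp q) : w = q := by
  have hq : (q : ℂ).im = 0 := Complex.ofReal_im q
  have h1 := Complex.log_exp (x := w) (by linarith [hw.1, pi_pos]) hw.2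
  have h2 := Complex.log_exp (x := (q : ℂ)) (by rw [hq]; linarith [pi_pos]) (by rw [hq]; exact pi_pos.le)
  rw [← h1, h, h2]

lemma integral_jump_mul (hν : ∀ᵐ α ∂ν, α ∈ Ioo (0:ℝ) 1) (h0 : ν ≠ 0) {c : ℝ} (hc : 0 < c)
    (q : ℝ) :
    Integrable (fun x => jump ν c x * (exp x / (exp x + exp q))) ∧
      ∫ x, jump ν c x * (exp x / (exp x + exp q)) = π / (c + mgf id ν q) := by
  have hdB := differentiable_complexMGF_of_unit hν
  set H : ℂ → ℂ := fun w => ((c : ℂ) + complexMGF id ν w)⁻¹ with hH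
  have hne : ∀ w : ℂ, w.im ∈ Icc 0 π → (c : ℂ) + complexMGF id ν w ≠ 0 :=
    fun w hw => add_complexMGF_ne_zero hν h0 hc.le hw
  have hqs : ((q : ℂ)).im ∈ Icc 0 π := by simp [pi_pos.le]
  have hHreal : ∀ x : ℝ, H x = ((c + mgf id ν x)⁻¹ : ℝ) := fun x => by
    simp [hH, complexMGF_ofReal]
  set φ : ℂ → ℂ := fun w => dslope H q w * Complex.exp w / dslope Complex.exp q w with hφ
  have hφeq : ∀ w : ℂ, w ≠ q → φ w = (H w - H q) * (Complex.exp w / (Complex.exp w - Complex.exp q)) := by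
    intro w hw
    have hw' : w - q ≠ 0 := sub_ne_zero.2 hw
    simp only [hφ]
    rw [dslope_of_ne _ hw, dslope_of_ne _ hw, slope_def_field, slope_def_field]
    by_cases hE : Complex.exp w - Complex.exp q = 0
    · simp [hE]
    · field_simp
  have hds : ∀ w : ℂ, w.im ∈ Icc 0 π → dslope Complex.exp q w ≠ 0 := by
    intro w hw
    by_cases hwq : w = q
    · subst hwq; rw [dslope_same, Complex.deriv_exp]; exact Complex.exp_ne_zero _
    · rw [dslope_of_ne _ hwq, slope_def_field]
      refine div_ne_zero (sub_ne_zero.2 fun h => hwq (exp_eq_exp_of_strip hw h)) (sub_ne_zero.2 hwq)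
  have hφd : ∀ w : ℂ, w.im ∈ Icc 0 π → DifferentiableAt ℂ φ w := by
    intro w hw
    have hU : IsOpen {w : ℂ | (c : ℂ) + complexMGF id ν w ≠ 0} :=
      isOpen_ne_fun (continuous_const.add hdB.continuous) continuous_const
    have h1 : DifferentiableAt ℂ (dslope H q) w := by
      have : DifferentiableOn ℂ (dslope H q) {w : ℂ | (c : ℂ) + complexMGF id ν w ≠ 0} :=
        (Complex.differentiableOn_dslope (hU.mem_nhds (hne _ hqs))).2 fun w hw =>
          (((hdB w).const_add _).inv hw).differentiableWithinAt
      exact this.differentiableAt (hU.mem_nhds (hne w hw))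
    have h2 : DifferentiableAt ℂ (dslope Complex.exp q) w := by
      have : DifferentiableOn ℂ (dslope Complex.exp q) univ :=
        (Complex.differentiableOn_dslope Filter.univ_mem).2 Complex.differentiable_exp.differentiableOn
      exact this.differentiableAt Filter.univ_mem
    exact (h1.mul Complex.differentiable_exp.differentiableAt).div h2 (hds w hw)
  have htopeq : ∀ x : ℝ, -(φ (x + π * Complex.I)).im =
      jump ν c x * (exp x / (exp x + exp q)) := by
    intro x
    have hx : (x + π * Complex.I : ℂ) ≠ q := by
      intro h; have := congrArg Complex.im h; simp [pi_ne_zero] at this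
    have hE : Complex.exp (x + π * Complex.I) = -(exp x : ℂ) := by
      rw [Complex.exp_add, Complex.exp_pi_mul_I]; simp
    have hk : Complex.exp (x + π * Complex.I) / (Complex.exp (x + π * Complex.I) - Complex.exp q) =
        ((exp x / (exp x + exp q) : ℝ) : ℂ) := by
      rw [hE, ← Complex.ofReal_exp]
      push_cast
      rw [← neg_add', neg_div_neg_eq]
    rw [hφeq _ hx, hk, Complex.im_mul_ofReal, Complex.sub_im, hHreal q, Complex.ofReal_im, jump]
    ring
  have hre (l : Filter ℝ) : Tendsto Complex.re (stripEnd l) l := tendsto_comap.mono_left inf_le_left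
  have hexpT : Tendsto (fun w => Complex.exp (-w)) (stripEnd atTop) (𝓝 0) := by
    rw [tendsto_zero_iff_norm_tendsto_zero]
    simp only [Complex.norm_exp, Complex.neg_re]
    exact tendsto_exp_neg_atTop_nhds_zero.comp (hre _)
  have hexpB : Tendsto (fun w => Complex.exp w) (stripEnd atBot) (𝓝 0) := by
    rw [tendsto_zero_iff_norm_tendsto_zero]
    simp only [Complex.norm_exp]
    exact tendsto_exp_atBot.comp (hre _)
  have hφT : Tendsto φ (stripEnd atTop) (𝓝 (-H q)) := by
    have h1 : Tendsto (fun w => (H w - H q) * (1 - Complex.exp q * Complex.exp (-w))⁻¹)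
        (stripEnd atTop) (𝓝 ((0 - H q) * (1 - Complex.exp q * 0)⁻¹)) :=
      ((tendsto_inv_add_complexMGF_atTop hν h0 hc.le).sub_const _).mul
        (((hexpT.const_mul _).const_sub 1).inv₀ (by simp))
    simp only [mul_zero, sub_zero, zero_sub, inv_one, mul_one] at h1
    refine h1.congr' ?_
    filter_upwards [(hre atTop).eventually (eventually_gt_atTop q)] with w hw
    rw [hφeq w (by rintro rfl; simp at hw)]
    congr 1
    have : (1 - Complex.exp q * Complex.exp (-w)) =
      (Complex.exp w - Complex.exp q) / Complex.exp w := by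
      rw [Complex.exp_neg, sub_div, div_self (Complex.exp_ne_zero _), div_eq_mul_inv]
    rw [this, inv_div]
  have hφB : Tendsto φ (stripEnd atBot) (𝓝 0) := by
    have h1 : Tendsto (fun w => (H w - H q) * (Complex.exp w / (Complex.exp w - Complex.exp q)))
        (stripEnd atBot) (𝓝 (((c:ℂ)⁻¹ - H q) * (0 / (0 - Complex.exp q)))) :=
      ((tendsto_inv_add_complexMGF_atBot hν hc).sub_const _).mul
        (hexpB.div (hexpB.sub_const _) (by simp))
    simp only [zero_div, mul_zero] at h1
    refine h1.congr' ?_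
    filter_upwards [(hre atBot).eventually (eventually_lt_atBot q)] with w hw
    rw [hφeq w (by rintro rfl; simp at hw)]
  have hreal : ∀ x : ℝ, (φ x).im = 0 := by
    have hcont : Continuous fun x : ℝ => (φ x).im := by
      refine Complex.continuous_im.comp (continuous_iff_continuousAt.2 fun x => ?_)
      exact ContinuousAt.comp (f := fun x : ℝ => (x : ℂ))
        (hφd x (by simp [pi_pos.le])).continuousAt (by fun_prop)
    refine congrFun (hcont.ext_on (dense_compl_singleton q) continuous_const fun x hx => ?_)
    have hx' : (x : ℂ) ≠ q := fun h => hx (Complex.ofReal_injective h)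
    change (φ x).im = 0
    rw [hφeq _ hx', hHreal, hHreal, ← Complex.ofReal_exp, ← Complex.ofReal_exp]
    norm_cast
  have := strip_integral hφd hreal (fun x => by
    have h1 := htopeq x
    have h2 := jump_nonneg hν h0 c x
    have : 0 ≤ jump ν c x * (exp x / (exp x + exp q)) := by positivity
    linarith) hφT hφB
  simp only [htopeq] at this
  refine ⟨this.1, this.2.trans ?_⟩
  rw [hHreal]
  simp only [← Complex.ofReal_neg, Complex.ofReal_re, Complex.zero_re]
  ring

end UnitSupport

lemma integrable_integral_swap_of_nonneg {X Y : Type*} [MeasurableSpace X] [MeasurableSpace Y]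
    {m : Measure X} {n : Measure Y} [SFinite m] [SFinite n] {f : X → Y → ℝ}
    (hf : AEStronglyMeasurable (Function.uncurry f) (m.prod n))
    (h0 : ∀ᵐ y ∂n, ∀ᵐ x ∂m, 0 ≤ f x y)
    (hy : ∀ᵐ y ∂n, Integrable (fun x => f x y) m)
    (hh : Integrable (fun y => ∫ x, f x y ∂m) n) :
    Integrable (fun x => ∫ y, f x y ∂n) m ∧
      ∫ x, ∫ y, f x y ∂n ∂m = ∫ y, ∫ x, f x y ∂m ∂n := by
  have hi : Integrable (Function.uncurry f) (m.prod n) := by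
    refine (integrable_prod_iff' hf).2 ⟨hy, hh.congr ?_⟩
    filter_upwards [h0] with y h
    exact integral_congr_ae (h.mono fun x hx => (norm_of_nonneg hx).symm)
  exact ⟨hi.integral_prod_left, integral_integral_swap hi⟩

lemma integrableOn_Ioi_zero_iff_comp_exp (g : ℝ → ℝ) :
    IntegrableOn g (Ioi 0) ↔ Integrable fun x => exp x * g (exp x) := by
  have := integrableOn_image_iff_integrableOn_abs_deriv_smul MeasurableSet.univ
    (fun x _ => (hasDerivAt_exp x).hasDerivWithinAt) exp_injective.injOn g
  simpa [image_univ, range_exp, abs_of_pos, exp_pos] using this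

lemma setIntegral_Ioi_zero_eq_comp_exp (g : ℝ → ℝ) :
    ∫ r in Ioi 0, g r = ∫ x, exp x * g (exp x) := by
  have := integral_image_eq_integral_abs_deriv_smul MeasurableSet.univ
    (fun x _ => (hasDerivAt_exp x).hasDerivWithinAt) exp_injective.injOn g
  simpa [image_univ, range_exp, abs_of_pos, exp_pos] using this

lemma integrableOn_exp_neg_mul_Ioi {p : ℝ} (hp : 0 < p) :
    IntegrableOn (fun t => exp (-(p * t))) (Ioi 0) ∧ ∫ t in Ioi 0, exp (-(p * t)) = 1 / p := by
  have h1 := integral_rpow_mul_exp_neg_mul_Ioi one_pos hp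
  simp only [sub_self, rpow_zero, one_mul, rpow_one, Gamma_one, mul_one] at h1
  exact ⟨.of_integral_ne_zero (by rw [h1]; positivity), h1⟩

lemma continuous_inv_Gamma : Continuous fun x : ℝ => (Gamma x)⁻¹ := by
  have h : (fun x : ℝ => (Gamma x)⁻¹) = fun x : ℝ => ((Complex.Gamma x)⁻¹).re := by
    ext x
    rw [Complex.Gamma_ofReal, ← Complex.ofReal_inv, Complex.ofReal_re]
  rw [h]
  exact Complex.continuous_re.comp
    (Complex.differentiable_one_div_Gamma.continuous.comp Complex.continuous_ofReal)

/-- The distributed-order kernel of the measure `ν`. -/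
noncomputable def orderKernel (ν : Measure ℝ) (t : ℝ) : ℝ := ∫ α, t ^ (-α) * (Gamma (1 - α))⁻¹ ∂ν

lemma orderKernel_nonneg {ν : Measure ℝ} (hν : ∀ᵐ α ∂ν, α ∈ Ioo (0:ℝ) 1) {t : ℝ} (ht : 0 ≤ t) :
    0 ≤ orderKernel ν t := by
  refine integral_nonneg_of_ae ?_
  filter_upwards [hν] with α hα
  have := Gamma_pos_of_pos (sub_pos.2 hα.2)
  exact mul_nonneg (rpow_nonneg ht _) (inv_nonneg.2 this.le)

section UnitSupport

variable {ν : Measure ℝ} [IsFiniteMeasure ν]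

/-- The jump density as a function of `r = e^x`, multiplied by `c / π`. -/
noncomputable def specDensity (ν : Measure ℝ) (c r : ℝ) : ℝ := c / π * jump ν c (log r)

lemma measurable_specDensity (hν : ∀ᵐ α ∂ν, α ∈ Ioo (0:ℝ) 1) (c : ℝ) :
    Measurable (specDensity ν c) := by
  have hB := (differentiable_complexMGF_of_unit hν).continuous
  have h : Measurable fun x : ℝ => (c : ℂ) + complexMGF id ν (x + π * Complex.I) :=
    Continuous.measurable (by fun_prop)
  have : Measurable (jump ν c) := (Complex.measurable_im.comp h.inv).neg
  exact (this.comp measurable_log).const_mul _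

lemma specDensity_nonneg (hν : ∀ᵐ α ∂ν, α ∈ Ioo (0:ℝ) 1) (h0 : ν ≠ 0) {c : ℝ} (hc : 0 < c)
    (r : ℝ) : 0 ≤ specDensity ν c r :=
  mul_nonneg (by positivity) (jump_nonneg hν h0 c _)

lemma integral_specDensity_div (hν : ∀ᵐ α ∂ν, α ∈ Ioo (0:ℝ) 1) (h0 : ν ≠ 0) {c : ℝ}
    (hc : 0 < c) :
    IntegrableOn (fun r => specDensity ν c r / r) (Ioi 0) ∧
      ∫ r in Ioi 0, specDensity ν c r / r = 1 := by
  have h := integral_jump hν h0 hc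
  have he : (fun x => exp x * (specDensity ν c (exp x) / exp x)) =
      fun x => c / π * jump ν c x := by
    ext x; rw [specDensity, log_exp]; field_simp
  rw [integrableOn_Ioi_zero_iff_comp_exp, setIntegral_Ioi_zero_eq_comp_exp, he]
  refine ⟨h.1.const_mul _, ?_⟩
  rw [integral_const_mul, h.2]
  field_simp

lemma integral_specDensity_div_add (hν : ∀ᵐ α ∂ν, α ∈ Ioo (0:ℝ) 1) (h0 : ν ≠ 0) {c : ℝ}
    (hc : 0 < c) {p : ℝ} (hp : 0 < p) :
    IntegrableOn (fun r => specDensity ν c r / (r + p)) (Ioi 0) ∧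
      ∫ r in Ioi 0, specDensity ν c r / (r + p) = c / (c + mgf id ν (log p)) := by
  have h := integral_jump_mul hν h0 hc (log p)
  rw [exp_log hp] at h
  have he : (fun x => exp x * (specDensity ν c (exp x) / (exp x + p))) =
      fun x => c / π * (jump ν c x * (exp x / (exp x + p))) := by
    ext x; rw [specDensity, log_exp]; ring
  rw [integrableOn_Ioi_zero_iff_comp_exp, setIntegral_Ioi_zero_eq_comp_exp, he]
  refine ⟨h.1.const_mul _, ?_⟩
  rw [integral_const_mul, h.2]
  field_simp

/-- The resolvent kernel: the Laplace transform of the density `specDensity`. -/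
noncomputable def resolventKernel (ν : Measure ℝ) (c t : ℝ) : ℝ :=
  ∫ r in Ioi 0, exp (-r * t) * specDensity ν c r

lemma measurable_resolventKernel (hν : ∀ᵐ α ∂ν, α ∈ Ioo (0:ℝ) 1) (c : ℝ) :
    Measurable (resolventKernel ν c) := by
  have := measurable_specDensity hν c
  have h : Measurable fun z : ℝ × ℝ => exp (-z.2 * z.1) * specDensity ν c z.2 := by fun_prop
  exact (h.stronglyMeasurable.integral_prod_right (ν := volume.restrict (Ioi 0))).measurable

lemma measurable_orderKernel : Measurable (orderKernel ν) := by
  have hG := continuous_inv_Gamma.measurable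
  have h : Measurable fun z : ℝ × ℝ => z.1 ^ (-z.2) * (Gamma (1 - z.2))⁻¹ :=
    (by fun_prop : Measurable fun z : ℝ × ℝ => z.1 ^ (-z.2)).mul
      (hG.comp (by fun_prop : Measurable fun z : ℝ × ℝ => 1 - z.2))
  exact (h.stronglyMeasurable.integral_prod_right (ν := ν)).measurable

lemma resolventKernel_nonneg (hν : ∀ᵐ α ∂ν, α ∈ Ioo (0:ℝ) 1) (h0 : ν ≠ 0) {c : ℝ} (hc : 0 < c)
    (t : ℝ) : 0 ≤ resolventKernel ν c t :=
  integral_nonneg fun r => mul_nonneg (exp_pos _).le (specDensity_nonneg hν h0 hc r)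

lemma laplace_resolventKernel (hν : ∀ᵐ α ∂ν, α ∈ Ioo (0:ℝ) 1) (h0 : ν ≠ 0) {c : ℝ}
    (hc : 0 < c) {p : ℝ} (hp : 0 < p) :
    IntegrableOn (fun t => exp (-(p * t)) * resolventKernel ν c t) (Ioi 0) ∧
      ∫ t in Ioi 0, exp (-(p * t)) * resolventKernel ν c t = c / (c + mgf id ν (log p)) := by
  have hm := measurable_specDensity hν c
  have hI := integral_specDensity_div_add hν h0 hc hp
  have hin : ∀ r ∈ Ioi (0:ℝ),
      (fun t => exp (-(p * t)) * (exp (-r * t) * specDensity ν c r)) =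
        fun t => exp (-((r + p) * t)) * specDensity ν c r := by
    intro r _; ext t; rw [← mul_assoc, ← exp_add]; congr 2; ring
  have hval : ∀ r ∈ Ioi (0:ℝ),
      ∫ t in Ioi (0:ℝ), exp (-(p * t)) * (exp (-r * t) * specDensity ν c r) =
        specDensity ν c r / (r + p) := by
    intro r hr
    rw [hin r hr, integral_mul_const, (integrableOn_exp_neg_mul_Ioi (add_pos hr hp)).2]
    ring
  have := integrable_integral_swap_of_nonneg (m := volume.restrict (Ioi (0:ℝ)))
    (n := volume.restrict (Ioi (0:ℝ)))
    (f := fun t r => exp (-(p * t)) * (exp (-r * t) * specDensity ν c r))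
    (Measurable.aestronglyMeasurable (by fun_prop))
    (ae_of_all _ fun r => ae_of_all _ fun t =>
      mul_nonneg (exp_pos _).le (mul_nonneg (exp_pos _).le (specDensity_nonneg hν h0 hc r)))
    ((ae_restrict_iff' measurableSet_Ioi).2 (ae_of_all _ fun r hr => by
      rw [hin r hr]
      exact (integrableOn_exp_neg_mul_Ioi (add_pos hr hp)).1.mul_const _))
    (hI.1.congr_fun (fun r hr => (hval r hr).symm) measurableSet_Ioi)
  simp only [integral_const_mul] at this
  refine ⟨this.1, this.2.trans ?_⟩
  rw [setIntegral_congr_fun measurableSet_Ioi hval, hI.2]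

lemma laplace_orderKernel (hν : ∀ᵐ α ∂ν, α ∈ Ioo (0:ℝ) 1) {p : ℝ} (hp : 0 < p) :
    IntegrableOn (fun t => exp (-(p * t)) * orderKernel ν t) (Ioi 0) ∧
      ∫ t in Ioi 0, exp (-(p * t)) * orderKernel ν t = mgf id ν (log p) / p := by
  have hG := continuous_inv_Gamma.measurable
  have hval : ∀ α ∈ Ioo (0:ℝ) 1,
      ∫ t in Ioi (0:ℝ), exp (-(p * t)) * (t ^ (-α) * (Gamma (1 - α))⁻¹) = exp (log p * α) / p := by
    intro α hα
    have hΓ := Gamma_pos_of_pos (sub_pos.2 hα.2)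
    have h1 := integral_rpow_mul_exp_neg_mul_Ioi (sub_pos.2 hα.2) hp
    have h2 : (fun t => exp (-(p * t)) * (t ^ (-α) * (Gamma (1 - α))⁻¹)) =
        fun t => t ^ (1 - α - 1) * exp (-(p * t)) * (Gamma (1 - α))⁻¹ := by
      ext t; rw [show 1 - α - 1 = -α by ring]; ring
    rw [h2, integral_mul_const, h1, mul_assoc, mul_inv_cancel₀ hΓ.ne', mul_one, one_div,
      inv_rpow hp.le, rpow_sub hp, rpow_one, rpow_def_of_pos hp, inv_div]
  have hae : ∀ᵐ α ∂ν, ∫ t in Ioi (0:ℝ), exp (-(p * t)) * (t ^ (-α) * (Gamma (1 - α))⁻¹) =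
      exp (log p * α) / p := hν.mono hval
  have hmeas : Measurable fun z : ℝ × ℝ =>
      exp (-(p * z.1)) * (z.1 ^ (-z.2) * (Gamma (1 - z.2))⁻¹) :=
    (by fun_prop : Measurable fun z : ℝ × ℝ => exp (-(p * z.1))).mul
    ((by fun_prop : Measurable fun z : ℝ × ℝ => z.1 ^ (-z.2)).mul
      (hG.comp (by fun_prop : Measurable fun z : ℝ × ℝ => 1 - z.2)))
  have := integrable_integral_swap_of_nonneg (m := volume.restrict (Ioi (0:ℝ))) (n := ν)
    (f := fun t α => exp (-(p * t)) * (t ^ (-α) * (Gamma (1 - α))⁻¹))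
    hmeas.aestronglyMeasurable
    (hν.mono fun α hα => (ae_restrict_iff' measurableSet_Ioi).2 (ae_of_all _ fun t ht =>
      mul_nonneg (exp_pos _).le (mul_nonneg (rpow_nonneg (le_of_lt ht) _)
        (inv_nonneg.2 (Gamma_pos_of_pos (sub_pos.2 hα.2)).le))))
    (hν.mono fun α hα => .of_integral_ne_zero (by rw [hval α hα]; positivity))
    (((integrable_exp_of_unit hν (log p)).div_const p).congr (hae.mono fun α h => h.symm))
  simp only [integral_const_mul] at this
  refine ⟨this.1, this.2.trans ?_⟩
  rw [integral_congr_ae hae, integral_div]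
  rfl

lemma integral_resolventKernel (hν : ∀ᵐ α ∂ν, α ∈ Ioo (0:ℝ) 1) (h0 : ν ≠ 0) {c : ℝ}
    (hc : 0 < c) {t : ℝ} (ht : 0 ≤ t) :
    IntervalIntegrable (resolventKernel ν c) volume 0 t ∧
      ∫ s in (0:ℝ)..t, resolventKernel ν c s =
        1 - ∫ r in Ioi (0:ℝ), exp (-r * t) / r * specDensity ν c r := by
  have hm := measurable_specDensity hν c
  have hI := integral_specDensity_div hν h0 hc
  have hI2 : IntegrableOn (fun r => exp (-r * t) / r * specDensity ν c r) (Ioi 0) := by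
    refine hI.1.mono' (Measurable.aestronglyMeasurable (by fun_prop)) ?_
    refine (ae_restrict_iff' measurableSet_Ioi).2 (ae_of_all _ fun r hr => ?_)
    have hr' : 0 < r := hr
    have h1 : exp (-r * t) ≤ 1 := exp_le_one_iff.2 (by nlinarith)
    have h2 := specDensity_nonneg hν h0 hc r
    rw [norm_of_nonneg (by positivity), div_mul_eq_mul_div]
    gcongr
    exact mul_le_of_le_one_left h2 h1
  have hint : ∀ r ∈ Ioi (0:ℝ), IntegrableOn (fun s => exp (-r * s) * specDensity ν c r) (Ioc 0 t) :=
    fun r _ => (Continuous.integrableOn_Icc (by fun_prop)).mono_set Ioc_subset_Icc_self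
  have hval : ∀ r ∈ Ioi (0:ℝ), ∫ s in Ioc 0 t, exp (-r * s) * specDensity ν c r =
      specDensity ν c r / r - exp (-r * t) / r * specDensity ν c r := by
    intro r hr
    have hr' : r ≠ 0 := (ne_of_gt hr)
    rw [integral_mul_const, ← intervalIntegral.integral_of_le ht,
      intervalIntegral.integral_comp_mul_left (fun x => exp x) (neg_ne_zero.2 hr'), integral_exp,
      smul_eq_mul, mul_zero, exp_zero]
    field_simp
    ring
  have := integrable_integral_swap_of_nonneg (m := volume.restrict (Ioc 0 t))
    (n := volume.restrict (Ioi (0:ℝ)))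
    (f := fun s r => exp (-r * s) * specDensity ν c r)
    (Measurable.aestronglyMeasurable (by fun_prop))
    (ae_of_all _ fun r => ae_of_all _ fun t =>
      (mul_nonneg (exp_pos _).le (specDensity_nonneg hν h0 hc r)))
    ((ae_restrict_iff' measurableSet_Ioi).2 (ae_of_all _ hint))
    (IntegrableOn.congr_fun (hI.1.sub hI2) (fun r hr => (hval r hr).symm) measurableSet_Ioi)
  refine ⟨(intervalIntegrable_iff_integrableOn_Ioc_of_le ht).2 this.1, ?_⟩
  rw [intervalIntegral.integral_of_le ht]
  refine this.2.trans ?_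
  rw [setIntegral_congr_fun measurableSet_Ioi hval, integral_sub hI.1 hI2, hI.2]

end UnitSupport

/-- The function `e^{-t} f(t)` restricted to `s`. -/
noncomputable def expOn (s : Set ℝ) (f : ℝ → ℝ) : ℝ → ℝ := s.indicator fun t => exp (-t) * f t

/-- Convolution of real functions on the line. -/
noncomputable abbrev realConv (f g : ℝ → ℝ) : ℝ → ℝ :=
  convolution f g (ContinuousLinearMap.mul ℝ ℝ) volume

lemma expOn_mul_expOn {s : Set ℝ} {t : ℝ} (h1 : Ioo 0 t ⊆ s) (h2 : s ⊆ Ioi 0) (f g : ℝ → ℝ) :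
    (fun τ => expOn s f τ * expOn (Ioi 0) g (t - τ)) =
      (Ioo 0 t).indicator fun τ => exp (-t) * (f τ * g (t - τ)) := by
  ext τ
  simp only [expOn, indicator]
  by_cases hτ : τ ∈ Ioo 0 t
  · have h3 : t - τ ∈ Ioi (0:ℝ) := sub_pos.2 hτ.2
    rw [if_pos (h1 hτ), if_pos hτ, if_pos h3]
    have : exp (-t) = exp (-τ) * exp (-(t - τ)) := by rw [← exp_add]; congr 1; ring
    rw [this]; ring
  · rw [if_neg hτ]
    by_cases hs : τ ∈ s
    · have h3 : t - τ ∉ Ioi (0:ℝ) := fun h => hτ ⟨h2 hs, sub_pos.1 h⟩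
      rw [if_neg h3, mul_zero]
    · rw [if_neg hs, zero_mul]

lemma realConv_expOn {s : Set ℝ} {t : ℝ} (ht : 0 ≤ t) (h1 : Ioo 0 t ⊆ s) (h2 : s ⊆ Ioi 0)
    (f g : ℝ → ℝ) :
    realConv (expOn s f) (expOn (Ioi 0) g) t = exp (-t) * ∫ τ in (0:ℝ)..t, f τ * g (t - τ) := by
  simp only [realConv, convolution_def, ContinuousLinearMap.mul_apply']
  rw [expOn_mul_expOn h1 h2, integral_indicator measurableSet_Ioo, integral_const_mul,
    intervalIntegral.integral_of_le ht, integral_Ioc_eq_integral_Ioo]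

lemma realConv_expOn_of_nonpos {s : Set ℝ} {t : ℝ} (ht : t ≤ 0) (h2 : s ⊆ Ioi 0) (f g : ℝ → ℝ) :
    realConv (expOn s f) (expOn (Ioi 0) g) t = 0 := by
  simp only [realConv, convolution_def, ContinuousLinearMap.mul_apply']
  rw [expOn_mul_expOn (by simp [Ioo_eq_empty_of_le ht]) h2]
  simp [Ioo_eq_empty_of_le ht]

lemma intervalIntegrable_of_convolutionExistsAt {s : Set ℝ} {t : ℝ} (ht : 0 ≤ t)
    (h1 : Ioo 0 t ⊆ s) (h2 : s ⊆ Ioi 0) {f g : ℝ → ℝ}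
    (h : ConvolutionExistsAt (expOn s f) (expOn (Ioi 0) g) t (ContinuousLinearMap.mul ℝ ℝ) volume) :
    IntervalIntegrable (fun τ => f τ * g (t - τ)) volume 0 t := by
  simp only [ConvolutionExistsAt, ContinuousLinearMap.mul_apply'] at h
  rw [expOn_mul_expOn h1 h2, integrable_indicator_iff measurableSet_Ioo] at h
  rw [intervalIntegrable_iff_integrableOn_Ioo_of_le ht]
  have := h.const_mul (exp t)
  refine this.congr (ae_of_all _ fun τ => ?_)
  simp only
  rw [← mul_assoc, ← exp_add]; simp

lemma integrable_expOn_Ioo {f : ℝ → ℝ} (hf : ∀ T > 0, IntervalIntegrable f volume 0 T) {T : ℝ}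
    (hT : 0 < T) : Integrable (expOn (Ioo 0 T) f) := by
  rw [expOn, integrable_indicator_iff measurableSet_Ioo]
  have := (intervalIntegrable_iff_integrableOn_Ioo_of_le hT.le).1 (hf T hT)
  refine Integrable.bdd_mul (c := 1) this (Continuous.aestronglyMeasurable (by fun_prop)) ?_
  refine (ae_restrict_iff' measurableSet_Ioo).2 (ae_of_all _ fun t ht => ?_)
  rw [norm_of_nonneg (exp_pos _).le]
  exact exp_le_one_iff.2 (by linarith [ht.1])

lemma ae_intervalIntegrable_mul_sub {f g : ℝ → ℝ}
    (hf : ∀ T > 0, IntervalIntegrable f volume 0 T) (hg : Integrable (expOn (Ioi 0) g)) :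
    ∀ᵐ t ∂(volume.restrict (Ioi (0:ℝ))),
      IntervalIntegrable (fun τ => f τ * g (t - τ)) volume 0 t := by
  have h : ∀ n : ℕ, ∀ᵐ t, ConvolutionExistsAt (expOn (Ioo 0 (n + 1)) f) (expOn (Ioi 0) g) t
      (ContinuousLinearMap.mul ℝ ℝ) volume := fun n =>
    (integrable_expOn_Ioo hf (by positivity)).ae_convolution_exists _ hg
  refine (ae_restrict_iff' measurableSet_Ioi).2 ?_
  filter_upwards [ae_all_iff.2 h] with t ht ht0
  obtain ⟨n, hn⟩ := exists_nat_gt t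
  exact intervalIntegrable_of_convolutionExistsAt (le_of_lt ht0)
    (Ioo_subset_Ioo_right (by linarith)) Ioo_subset_Ioi_self (ht n)

/-- A convolution of nonnegative functions is determined by the Laplace transforms. -/
lemma realConv_ae_eq_of_laplace {A B E : ℝ → ℝ} (hA : Measurable A) (hB : Measurable B)
    (hE : Measurable E) (hA0 : ∀ x, 0 ≤ A x) (hB0 : ∀ x, 0 ≤ B x) (hE0 : ∀ x, 0 ≤ E x)
    (hAi : ∀ s < 1, Integrable fun x => exp (s * x) * A x)
    (hBi : ∀ s < 1, Integrable fun x => exp (s * x) * B x)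
    (hEi : ∀ s < 1, Integrable fun x => exp (s * x) * E x)
    (h : ∀ s < 1, (∫ x, exp (s * x) * A x) * (∫ x, exp (s * x) * B x) =
      ∫ x, exp (s * x) * E x) :
    ∀ᵐ x, realConv A B x = E x := by
  set μ : (ℝ → ℝ) → Measure ℝ := fun F => volume.withDensity fun x => ENNReal.ofReal (F x) with hμ
  have hl : ∀ F : ℝ → ℝ, Measurable F → (∀ x, 0 ≤ F x) →
      (∀ s < 1, Integrable fun x => exp (s * x) * F x) → ∀ s < 1,
      ∫⁻ x, ENNReal.ofReal (exp (s * x)) ∂(μ F) = ENNReal.ofReal (∫ x, exp (s * x) * F x) := by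
    intro F hF hF0 hFi s hs
    rw [hμ, lintegral_withDensity_eq_lintegral_mul _ (by fun_prop) (by fun_prop),
      ofReal_integral_eq_lintegral_ofReal (hFi s hs)
        (ae_of_all _ fun x => mul_nonneg (exp_pos _).le (hF0 x))]
    refine lintegral_congr fun x => ?_
    simp only [Pi.mul_apply]
    rw [ENNReal.ofReal_mul (exp_pos _).le, mul_comm]
  have hfin : ∀ F : ℝ → ℝ, Measurable F → (∀ x, 0 ≤ F x) →
      (∀ s < 1, Integrable fun x => exp (s * x) * F x) → IsFiniteMeasure (μ F) := by
    intro F hF hF0 hFi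
    have := hl F hF hF0 hFi 0 one_pos
    simp only [zero_mul, exp_zero, ENNReal.ofReal_one, lintegral_one] at this
    exact ⟨by rw [this]; exact ENNReal.ofReal_lt_top⟩
  have := hfin A hA hA0 hAi
  have := hfin B hB hB0 hBi
  have := hfin E hE hE0 hEi
  have hconv : ∀ s < 1, ∫⁻ x, ENNReal.ofReal (exp (s * x)) ∂(μ A ∗ μ B) =
      ENNReal.ofReal (∫ x, exp (s * x) * E x) := by
    intro s hs
    rw [Measure.lintegral_conv (by fun_prop)]
    simp only [mul_add, exp_add, ENNReal.ofReal_mul (exp_pos _).le]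
    have h1 : ∀ x, ∫⁻ y, ENNReal.ofReal (exp (s * x)) * ENNReal.ofReal (exp (s * y)) ∂(μ B) =
        ENNReal.ofReal (exp (s * x)) * ENNReal.ofReal (∫ x, exp (s * x) * B x) := by
      intro x
      rw [lintegral_const_mul _ (by fun_prop), hl B hB hB0 hBi s hs]
    simp only [h1]
    rw [lintegral_mul_const _ (by fun_prop), hl A hA hA0 hAi s hs, ← ENNReal.ofReal_mul, h s hs]
    exact integral_nonneg fun x => mul_nonneg (exp_pos _).le (hA0 x)
  have heq : μ A ∗ μ B = μ E :=
    ext_of_lintegral_exp (fun s hs => by rw [hconv s hs]; exact ENNReal.ofReal_ne_top)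
      fun s hs => by rw [hconv s hs, hl E hE hE0 hEi s hs]
  rw [hμ] at heq
  simp only at heq
  rw [conv_withDensity_eq_lconvolution (by fun_prop) (by fun_prop)] at heq
  have hm := measurable_lconvolution (f := fun x => ENNReal.ofReal (A x))
    (g := fun x => ENNReal.ofReal (B x)) volume (by fun_prop) (by fun_prop)
  have hae := (withDensity_eq_iff_of_sigmaFinite hm.aemeasurable
    (Measurable.aemeasurable (by fun_prop))).1 heq
  filter_upwards [hae] with x hx
  simp only [realConv, convolution_def, ContinuousLinearMap.mul_apply']
  rw [integral_eq_lintegral_of_nonneg_ae (ae_of_all _ fun y => mul_nonneg (hA0 _) (hB0 _))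
    (Measurable.aestronglyMeasurable (by fun_prop))]
  rw [lconvolution_def] at hx
  simp only [ENNReal.ofReal_mul (hA0 _)]
  simp only [neg_add_eq_sub] at hx
  rw [hx, ENNReal.toReal_ofReal (hE0 x)]

lemma realConv_assoc_ae {f a b : ℝ → ℝ} (hf : Integrable f) (ha : Integrable a)
    (hb : Integrable b) :
    ∀ᵐ t, realConv (realConv f a) b t = realConv f (realConv a b) t := by
  filter_upwards [hf.norm.ae_convolution_exists (ContinuousLinearMap.mul ℝ ℝ)
    (ha.norm.integrable_convolution (ContinuousLinearMap.mul ℝ ℝ) hb.norm)] with t ht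
  exact convolution_assoc _ _ _ _ (fun x y z => mul_assoc x y z) hf.1 ha.1 hb.1
    (hf.ae_convolution_exists _ ha) (ha.norm.ae_convolution_exists _ hb.norm) ht

lemma realConv_congr_right {f g h : ℝ → ℝ} (hgh : ∀ᵐ t, g t = h t) (t : ℝ) :
    realConv f g t = realConv f h t := by
  simp only [realConv, convolution_def, ContinuousLinearMap.mul_apply']
  refine integral_congr_ae ?_
  have := (quasiMeasurePreserving_sub_left_of_right_invariant volume t).ae hgh
  filter_upwards [this] with τ hτ
  rw [hτ]

section UnitSupport

variable {ν : Measure ℝ} [IsFiniteMeasure ν]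

lemma exp_mul_expOn (s : ℝ) (f : ℝ → ℝ) : (fun x => exp (s * x) * expOn (Ioi 0) f x) =
    (Ioi 0).indicator fun t => exp (-((1 - s) * t)) * f t := by
  ext t
  simp only [expOn, indicator]
  split_ifs
  · rw [← mul_assoc, ← exp_add]; congr 2; ring
  · simp

lemma expOn_kernel (hν : ∀ᵐ α ∂ν, α ∈ Ioo (0:ℝ) 1) {c : ℝ} (hc : 0 < c) :
    Measurable (expOn (Ioi 0) fun t => orderKernel ν t + c) ∧
    (∀ t, 0 ≤ expOn (Ioi 0) (fun t => orderKernel ν t + c) t) ∧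
    ∀ s < 1, Integrable (fun x => exp (s * x) * expOn (Ioi 0) (fun t => orderKernel ν t + c) x) ∧
      ∫ x, exp (s * x) * expOn (Ioi 0) (fun t => orderKernel ν t + c) x =
        (mgf id ν (log (1 - s)) + c) / (1 - s) := by
  have hm := measurable_orderKernel (ν := ν)
  refine ⟨Measurable.indicator (by fun_prop) measurableSet_Ioi, fun t => ?_, fun s hs => ?_⟩
  · exact indicator_nonneg (fun t ht => mul_nonneg (exp_pos _).le
      (add_nonneg (orderKernel_nonneg hν (le_of_lt ht)) hc.le)) t
  · have hp : 0 < 1 - s := sub_pos.2 hs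
    rw [exp_mul_expOn, integrable_indicator_iff measurableSet_Ioi,
      integral_indicator measurableSet_Ioi]
    have h1 := laplace_orderKernel hν hp
    have h2 := integrableOn_exp_neg_mul_Ioi hp
    simp only [mul_add]
    refine ⟨h1.1.add (h2.1.mul_const c), ?_⟩
    rw [integral_add h1.1 (h2.1.mul_const c), h1.2, integral_mul_const, h2.2]
    ring

lemma expOn_resolvent (hν : ∀ᵐ α ∂ν, α ∈ Ioo (0:ℝ) 1) (h0 : ν ≠ 0) {c : ℝ} (hc : 0 < c) :
    Measurable (expOn (Ioi 0) (resolventKernel ν c)) ∧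
    (∀ t, 0 ≤ expOn (Ioi 0) (resolventKernel ν c) t) ∧
    ∀ s < 1, Integrable (fun x => exp (s * x) * expOn (Ioi 0) (resolventKernel ν c) x) ∧
      ∫ x, exp (s * x) * expOn (Ioi 0) (resolventKernel ν c) x =
        c / (c + mgf id ν (log (1 - s))) := by
  have hm := measurable_resolventKernel hν c
  refine ⟨Measurable.indicator (by fun_prop) measurableSet_Ioi, fun t => ?_, fun s hs => ?_⟩
  · exact indicator_nonneg (fun t _ => mul_nonneg (exp_pos _).le
      (resolventKernel_nonneg hν h0 hc t)) t
  · rw [exp_mul_expOn, integrable_indicator_iff measurableSet_Ioi,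
      integral_indicator measurableSet_Ioi]
    exact laplace_resolventKernel hν h0 hc (sub_pos.2 hs)

lemma expOn_const {c : ℝ} (hc : 0 < c) :
    Measurable (expOn (Ioi 0) fun _ => c) ∧ (∀ t, 0 ≤ expOn (Ioi 0) (fun _ => c) t) ∧
    ∀ s < 1, Integrable (fun x => exp (s * x) * expOn (Ioi 0) (fun _ => c) x) ∧
      ∫ x, exp (s * x) * expOn (Ioi 0) (fun _ => c) x = c / (1 - s) := by
  refine ⟨Measurable.indicator (by fun_prop) measurableSet_Ioi, fun t => ?_, fun s hs => ?_⟩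
  · exact indicator_nonneg (fun t _ => mul_nonneg (exp_pos _).le hc.le) t
  · have h2 := integrableOn_exp_neg_mul_Ioi (sub_pos.2 hs)
    rw [exp_mul_expOn, integrable_indicator_iff measurableSet_Ioi,
      integral_indicator measurableSet_Ioi, integral_mul_const, h2.2]
    exact ⟨h2.1.mul_const c, by ring⟩

/-- The function `resolventKernel` is the resolvent of the kernel `orderKernel + c`. -/
lemma realConv_kernel_resolvent (hν : ∀ᵐ α ∂ν, α ∈ Ioo (0:ℝ) 1) (h0 : ν ≠ 0) {c : ℝ}
    (hc : 0 < c) :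
    (∀ᵐ t, realConv (expOn (Ioi 0) fun t => orderKernel ν t + c)
      (expOn (Ioi 0) (resolventKernel ν c)) t = expOn (Ioi 0) (fun _ => c) t) ∧
    ∀ᵐ t, realConv (expOn (Ioi 0) (resolventKernel ν c))
      (expOn (Ioi 0) fun t => orderKernel ν t + c) t = expOn (Ioi 0) (fun _ => c) t := by
  obtain ⟨hA, hA0, hAi⟩ := expOn_kernel hν hc
  obtain ⟨hB, hB0, hBi⟩ := expOn_resolvent hν h0 hc
  obtain ⟨hE, hE0, hEi⟩ := expOn_const hc
  have hprod : ∀ s < 1, (mgf id ν (log (1 - s)) + c) / (1 - s) *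
      (c / (c + mgf id ν (log (1 - s)))) = c / (1 - s) := by
    intro s hs
    have h1 : (1 - s) ≠ 0 := (sub_pos.2 hs).ne'
    have h2 : c + mgf id ν (log (1 - s)) ≠ 0 := (add_pos_of_pos_of_nonneg hc mgf_nonneg).ne'
    field_simp
    ring
  constructor
  · refine realConv_ae_eq_of_laplace hA hB hE hA0 hB0 hE0 (fun s hs => (hAi s hs).1)
      (fun s hs => (hBi s hs).1) (fun s hs => (hEi s hs).1) fun s hs => ?_
    rw [(hAi s hs).2, (hBi s hs).2, (hEi s hs).2, hprod s hs]
  · refine realConv_ae_eq_of_laplace hB hA hE hB0 hA0 hE0 (fun s hs => (hBi s hs).1)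
      (fun s hs => (hAi s hs).1) (fun s hs => (hEi s hs).1) fun s hs => ?_
    rw [(hAi s hs).2, (hBi s hs).2, (hEi s hs).2, mul_comm, hprod s hs]

lemma integrable_expOn_kernel (hν : ∀ᵐ α ∂ν, α ∈ Ioo (0:ℝ) 1) {c : ℝ} (hc : 0 < c) :
    Integrable (expOn (Ioi 0) fun t => orderKernel ν t + c) := by
  simpa using ((expOn_kernel hν hc).2.2 0 one_pos).1

lemma integrable_expOn_resolvent (hν : ∀ᵐ α ∂ν, α ∈ Ioo (0:ℝ) 1) (h0 : ν ≠ 0) {c : ℝ}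
    (hc : 0 < c) : Integrable (expOn (Ioi 0) (resolventKernel ν c)) := by
  simpa using ((expOn_resolvent hν h0 hc).2.2 0 one_pos).1

lemma integral_kernel_add_const (hν : ∀ᵐ α ∂ν, α ∈ Ioo (0:ℝ) 1) {c : ℝ} (hc : 0 < c) {f : ℝ → ℝ}
    (hf : ∀ T > 0, IntervalIntegrable f volume 0 T) :
    ∀ᵐ t ∂(volume.restrict (Ioi (0:ℝ))),
      ∫ τ in (0:ℝ)..t, f τ * (orderKernel ν (t - τ) + c) =
        (∫ τ in (0:ℝ)..t, orderKernel ν (t - τ) * f τ) + c * ∫ τ in (0:ℝ)..t, f τ := by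
  filter_upwards [ae_intervalIntegrable_mul_sub hf (integrable_expOn_kernel hν hc),
    ae_restrict_mem measurableSet_Ioi] with t ht ht0
  have h1 : IntervalIntegrable (fun τ => f τ * c) volume 0 t := (hf t ht0).mul_const c
  have h2 : IntervalIntegrable (fun τ => orderKernel ν (t - τ) * f τ) volume 0 t := by
    refine (ht.sub h1).congr (fun τ _ => ?_)
    ring
  rw [← intervalIntegral.integral_const_mul, ← intervalIntegral.integral_add h2 ((hf t ht0).const_mul c)]
  exact intervalIntegral.integral_congr fun τ _ => by ring

lemma integral_kernel_mul_resolvent (hν : ∀ᵐ α ∂ν, α ∈ Ioo (0:ℝ) 1) (h0 : ν ≠ 0) {c : ℝ}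
    (hc : 0 < c) :
    ∀ᵐ t ∂(volume.restrict (Ioi (0:ℝ))),
      (∫ τ in (0:ℝ)..t, orderKernel ν (t - τ) * resolventKernel ν c τ) +
        c * ∫ τ in (0:ℝ)..t, resolventKernel ν c τ = c := by
  filter_upwards [integral_kernel_add_const hν hc fun T hT => (integral_resolventKernel hν h0 hc hT.le).1,
    ae_restrict_of_ae (realConv_kernel_resolvent hν h0 hc).2, ae_restrict_mem measurableSet_Ioi]
    with t h1 h2 ht
  rw [← h1]
  rw [realConv_expOn (le_of_lt ht) Ioo_subset_Ioi_self Subset.rfl, expOn, indicator_of_mem ht] at h2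
  exact mul_left_cancel₀ (exp_pos _).ne' h2

lemma integral_eq_of_kernel_equation (hν : ∀ᵐ α ∂ν, α ∈ Ioo (0:ℝ) 1) (h0 : ν ≠ 0) {c : ℝ}
    (hc : 0 < c) {f : ℝ → ℝ} {d : ℝ} (hf : ∀ T > 0, IntervalIntegrable f volume 0 T)
    (h : ∀ᵐ t ∂(volume.restrict (Ioi (0:ℝ))), (∫ τ in (0:ℝ)..t, orderKernel ν (t - τ) * f τ) +
      c * (d + ∫ τ in (0:ℝ)..t, f τ) = 0) :
    ∀ t ≥ 0, ∫ τ in (0:ℝ)..t, f τ = -d * ∫ τ in (0:ℝ)..t, resolventKernel ν c τ := by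
  set g := resolventKernel ν c with hg
  have hgi : ∀ T > 0, IntervalIntegrable g volume 0 T :=
    fun T hT => (integral_resolventKernel hν h0 hc hT.le).1
  have hae : ∀ T > 0, ∀ᵐ t, t ∈ Ioo 0 T →
      ∫ τ in (0:ℝ)..t, f τ = -d * ∫ τ in (0:ℝ)..t, g τ := by
    intro T hT
    set F := expOn (Ioo 0 T) f
    set A := expOn (Ioi 0) fun t => orderKernel ν t + c with hA
    set B := expOn (Ioi 0) g with hB
    have hFA : ∀ᵐ τ, τ < T → realConv F A τ = expOn (Ioi 0) (fun _ => -(c * d)) τ := by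
      have := (ae_restrict_iff' measurableSet_Ioi).1 (h.and (integral_kernel_add_const hν hc hf))
      filter_upwards [this] with τ hτ hτT
      rcases le_or_gt τ 0 with h0 | h0
      · rw [realConv_expOn_of_nonpos h0 Ioo_subset_Ioi_self, expOn, indicator_of_notMem (by simpa using h0)]
      · obtain ⟨h1, h2⟩ := hτ h0
        rw [realConv_expOn h0.le (Ioo_subset_Ioo_right hτT.le) Ioo_subset_Ioi_self, expOn,
          indicator_of_mem (by simpa using h0), h2]
        congr 1
        linarith
    filter_upwards [realConv_assoc_ae (integrable_expOn_Ioo hf hT) (integrable_expOn_kernel hν hc)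
      (integrable_expOn_resolvent hν h0 hc)] with t ht htT
    have h1 : realConv (realConv F A) B t = realConv (expOn (Ioi 0) fun _ => -(c * d)) B t := by
      change ∫ τ, realConv F A τ * B (t - τ) =
        ∫ τ, expOn (Ioi 0) (fun _ => -(c * d)) τ * B (t - τ)
      refine integral_congr_ae ?_
      filter_upwards [hFA] with τ hτ
      by_cases h : τ < T
      · rw [hτ h]
      · have : B (t - τ) = 0 := by
          rw [hB, expOn, indicator_of_notMem]
          simp only [mem_Ioi, not_lt, tsub_le_iff_right, zero_add]
          linarith [htT.2]
        rw [this, mul_zero, mul_zero]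
    rw [h1, realConv_congr_right (realConv_kernel_resolvent hν h0 hc).1,
      realConv_expOn htT.1.le Ioo_subset_Ioi_self Subset.rfl,
      realConv_expOn htT.1.le (Ioo_subset_Ioo_right htT.2.le) Ioo_subset_Ioi_self,
      intervalIntegral.integral_const_mul, intervalIntegral.integral_mul_const,
      intervalIntegral.integral_comp_sub_left (fun x => g x)] at ht
    simp only [sub_self, sub_zero] at ht
    have h3 := mul_left_cancel₀ (exp_pos _).ne' ht
    have h4 : c * (∫ τ in (0:ℝ)..t, f τ) = c * (-d * ∫ τ in (0:ℝ)..t, g τ) := by linarith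
    exact mul_left_cancel₀ hc.ne' h4
  intro t ht
  have hc1 : ∀ u : ℝ → ℝ, (∀ T > 0, IntervalIntegrable u volume 0 T) → ∀ T > 0,
      ContinuousOn (fun t => ∫ τ in (0:ℝ)..t, u τ) (Icc 0 T) := fun u hu T hT =>
    intervalIntegral.continuousOn_primitive_interval
      (by rw [uIcc_of_le hT.le]; exact (intervalIntegrable_iff_integrableOn_Icc_of_le hT.le).1 (hu T hT)) |>.mono
      (by rw [uIcc_of_le hT.le])
  have hT : 0 < t + 1 := by linarith
  have hEqOn : EqOn (fun t => ∫ τ in (0:ℝ)..t, f τ) (fun t => -d * ∫ τ in (0:ℝ)..t, g τ)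
      (Ioo 0 (t + 1)) := by
    refine Measure.eqOn_open_of_ae_eq (μ := volume)
      ((ae_restrict_iff' measurableSet_Ioo).2 (hae _ hT)) isOpen_Ioo ?_ ?_
    · exact (hc1 f hf _ hT).mono Ioo_subset_Icc_self
    · exact ((hc1 g hgi _ hT).mono Ioo_subset_Icc_self).const_mul _
  rcases ht.eq_or_lt with rfl | ht'
  · simp
  · exact hEqOn ⟨ht', by linarith⟩

end UnitSupport

/-- The measure on `(0,1)` with density `μ`. -/
noncomputable def orderMeasure (μ : ℝ → ℝ) : Measure ℝ :=
  (volume.restrict (Ioo 0 1)).withDensity fun α => ENNReal.ofReal (μ α)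

section OrderMeasure

variable {μ : ℝ → ℝ}

lemma orderMeasure_ae_mem : ∀ᵐ α ∂(orderMeasure μ), α ∈ Ioo (0:ℝ) 1 :=
  (withDensity_absolutelyContinuous _ _).ae_le (ae_restrict_mem measurableSet_Ioo)

lemma isFiniteMeasure_orderMeasure (hint : IntegrableOn μ (Ioo 0 1)) :
    IsFiniteMeasure (orderMeasure μ) :=
  isFiniteMeasure_withDensity_ofReal hint.2

lemma integral_orderMeasure (hmeas : Measurable μ) (hnn : ∀ α ∈ Icc (0:ℝ) 1, 0 ≤ μ α)
    (f : ℝ → ℝ) : ∫ α, f α ∂(orderMeasure μ) = ∫ α in Ioo (0:ℝ) 1, f α * μ α := by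
  rw [orderMeasure, integral_withDensity_eq_integral_toReal_smul (by fun_prop)
    (ae_of_all _ fun α => ENNReal.ofReal_lt_top)]
  refine setIntegral_congr_fun measurableSet_Ioo fun α hα => ?_
  simp only [smul_eq_mul]
  rw [ENNReal.toReal_ofReal (hnn α (Ioo_subset_Icc_self hα)), mul_comm]

lemma orderMeasure_ne_zero (hmeas : Measurable μ) (hnn : ∀ α ∈ Icc (0:ℝ) 1, 0 ≤ μ α)
    (hpos : 0 < ∫ α in Ioo (0:ℝ) 1, μ α) : orderMeasure μ ≠ 0 := by
  intro h
  have := integral_orderMeasure hmeas hnn fun _ => 1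
  simp only [h, integral_zero_measure, one_mul] at this
  exact hpos.ne this

lemma kker_eq_orderKernel (hmeas : Measurable μ) (hnn : ∀ α ∈ Icc (0:ℝ) 1, 0 ≤ μ α) (t : ℝ) :
    kker μ t = orderKernel (orderMeasure μ) t := by
  rw [kker, orderKernel, integral_orderMeasure hmeas hnn]
  congr 1 with α
  ring

lemma Gfun_eq_jump (hmeas : Measurable μ) (hnn : ∀ α ∈ Icc (0:ℝ) 1, 0 ≤ μ α)
    (hint : IntegrableOn μ (Ioo 0 1)) (lam : ℝ) {r : ℝ} (hr : 0 < r) :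
    Gfun μ lam r = jump (orderMeasure μ) lam (log r) := by
  have := isFiniteMeasure_orderMeasure hint
  rw [jump_eq orderMeasure_ae_mem, sinMoment, Gfun, integral_orderMeasure hmeas hnn,
    integral_orderMeasure hmeas hnn]
  simp only [rpow_def_of_pos hr]

lemma vfun_eq (hmeas : Measurable μ) (hnn : ∀ α ∈ Icc (0:ℝ) 1, 0 ≤ μ α)
    (hint : IntegrableOn μ (Ioo 0 1)) (hpos : 0 < ∫ α in Ioo (0:ℝ) 1, μ α) {lam : ℝ}
    (hlam : 0 < lam) (v₀ : ℝ) {t : ℝ} (ht : 0 ≤ t) :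
    vfun μ lam v₀ t = v₀ * (1 - ∫ s in (0:ℝ)..t, resolventKernel (orderMeasure μ) lam s) := by
  have := isFiniteMeasure_orderMeasure hint
  rw [(integral_resolventKernel orderMeasure_ae_mem (orderMeasure_ne_zero hmeas hnn hpos) hlam
    ht).2, sub_sub_cancel, vfun, mul_assoc, ← integral_const_mul]
  congr 1
  refine setIntegral_congr_fun measurableSet_Ioi fun r hr => ?_
  simp only [specDensity, Gfun_eq_jump hmeas hnn hint lam hr]
  ring

end OrderMeasure

end DistributedOrder

/-- Theorem `tw1`: under (aa) and (f1), the unique absolutely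
continuous solution of `(k * v')(t) + λ v(t) = 0` (a.e. `t > 0`), `v(0) = v₀`,
is given by the explicit formula (postacv). -/
theorem ode_explicit_formula (μ : ℝ → ℝ) (lam v₀ : ℝ) (hlam : 0 < lam)
    (hmeas : Measurable μ)
    (hnn : ∀ α ∈ Icc (0:ℝ) 1, 0 ≤ μ α)
    (hint : IntegrableOn μ (Ioo 0 1))
    (hpos : 0 < ∫ α in Ioo (0:ℝ) 1, μ α)
    (hf1 : IntegrableOn (fun α => μ α / α) (Ioo 0 1)) :
    (∃ v' : ℝ → ℝ,
      (∀ T > 0, IntervalIntegrable v' volume 0 T) ∧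
      (∀ t ∈ Ici (0:ℝ), vfun μ lam v₀ t = v₀ + ∫ s in (0:ℝ)..t, v' s) ∧
      (∀ᵐ t ∂(volume.restrict (Ioi (0:ℝ))),
        (∫ τ in (0:ℝ)..t, kker μ (t - τ) * v' τ) + lam * vfun μ lam v₀ t = 0)) ∧
    (∀ w w' : ℝ → ℝ,
      (∀ T > 0, IntervalIntegrable w' volume 0 T) →
      (∀ t ∈ Ici (0:ℝ), w t = v₀ + ∫ s in (0:ℝ)..t, w' s) →
      (∀ᵐ t ∂(volume.restrict (Ioi (0:ℝ))),
        (∫ τ in (0:ℝ)..t, kker μ (t - τ) * w' τ) + lam * w t = 0) →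
      ∀ t ∈ Ici (0:ℝ), w t = vfun μ lam v₀ t) := by
  have := isFiniteMeasure_orderMeasure hint
  have hν : ∀ᵐ α ∂(orderMeasure μ), α ∈ Ioo (0:ℝ) 1 := orderMeasure_ae_mem
  have h0 := orderMeasure_ne_zero hmeas hnn hpos
  have hv := fun t ht => vfun_eq hmeas hnn hint hpos hlam v₀ (t := t) ht
  refine ⟨⟨fun t => -v₀ * resolventKernel (orderMeasure μ) lam t, fun T hT =>
    (integral_resolventKernel hν h0 hlam hT.le).1.const_mul _, fun t ht => ?_, ?_⟩, ?_⟩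
  · rw [hv t ht, intervalIntegral.integral_const_mul]
    ring
  · filter_upwards [integral_kernel_mul_resolvent hν h0 hlam, ae_restrict_mem measurableSet_Ioi]
      with t h ht
    simp only [kker_eq_orderKernel hmeas hnn, mul_left_comm _ (-v₀)]
    rw [hv t (le_of_lt ht), intervalIntegral.integral_const_mul]
    linear_combination (-v₀) * h
  · intro w w' hw' hw heq t ht
    rw [hv t ht, hw t ht, integral_eq_of_kernel_equation (d := v₀) hν h0 hlam hw' ?_ t ht]
    · ring
    · filter_upwards [heq, ae_restrict_mem measurableSet_Ioi] with t h ht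
      simpa only [kker_eq_orderKernel hmeas hnn, hw t (mem_Ici.2 (mem_Ioi.1 ht).le)] using h
end

section
/- Assume λ > 0, v₀ ∈ ℝ, and μ satisfies (aa) and (f1). Let v(t) = v₀ (λ/π) ∫₀^∞ (e^{−rt}/r) G(r) dr. Then for every p ∈ ℂ with Re p > 0, the Laplace transform of v satisfies ∫₀^∞ e^{−pt} v(t) dt = v₀ · (∫₀¹ p^α μ(α) dα) / ( p [ ∫₀¹ p^α μ(α) dα + λ ] ), where p^α is the principal branch. -/
open MeasureTheory Set Real

/-- The function `z ↦ ∫₀¹ z ^ α μ(α) dα` in the logarithmic coordinate `w = log z`. -/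
noncomputable def expMoment (μ : ℝ → ℝ) (w : ℂ) : ℂ :=
  ∫ α in Ioo (0:ℝ) 1, Complex.exp (α * w) * (μ α : ℂ)

section ExpMoment

variable {μ : ℝ → ℝ}

theorem norm_exp_mul_le {α R : ℝ} {w : ℂ} (hα : α ∈ Ioo (0:ℝ) 1) (hw : ‖w‖ ≤ R) :
    ‖Complex.exp (α * w)‖ ≤ Real.exp R := by
  rw [Complex.norm_exp, Real.exp_le_exp]
  calc (α * w : ℂ).re ≤ ‖(α * w : ℂ)‖ := Complex.re_le_norm _
    _ = α * ‖w‖ := by rw [norm_mul, Complex.norm_real, Real.norm_of_nonneg hα.1.le]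
    _ ≤ 1 * ‖w‖ := by gcongr; exact hα.2.le
    _ ≤ R := by linarith

theorem aestronglyMeasurable_expMoment_integrand (hint : IntegrableOn μ (Ioo 0 1)) (w : ℂ) :
    AEStronglyMeasurable (fun α : ℝ => Complex.exp (α * w) * (μ α : ℂ))
      (volume.restrict (Ioo (0:ℝ) 1)) :=
  AEStronglyMeasurable.mul (Continuous.aestronglyMeasurable (by fun_prop))
    hint.ofReal.aestronglyMeasurable

theorem integrableOn_expMoment_integrand (hint : IntegrableOn μ (Ioo 0 1)) (w : ℂ) :
    IntegrableOn (fun α : ℝ => Complex.exp (α * w) * (μ α : ℂ)) (Ioo (0:ℝ) 1) := by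
  refine (hint.norm.const_mul (Real.exp ‖w‖)).mono'
    (aestronglyMeasurable_expMoment_integrand hint w) ?_
  filter_upwards [ae_restrict_mem measurableSet_Ioo] with α hα
  rw [norm_mul, Complex.norm_real]
  gcongr
  exact norm_exp_mul_le hα le_rfl

theorem differentiable_expMoment (hint : IntegrableOn μ (Ioo 0 1)) :
    Differentiable ℂ (expMoment μ) := by
  intro w₀
  refine (hasDerivAt_integral_of_dominated_loc_of_deriv_le
    (bound := fun α => Real.exp (‖w₀‖ + 1) * ‖μ α‖)
    (F' := fun w α => Complex.exp (α * w) * α * (μ α : ℂ))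
    (Metric.ball_mem_nhds w₀ one_pos)
    (Filter.Eventually.of_forall (aestronglyMeasurable_expMoment_integrand hint))
    (integrableOn_expMoment_integrand hint w₀) ?_ ?_ (hint.norm.const_mul _)
    ?_).2.differentiableAt
  · exact AEStronglyMeasurable.mul (Continuous.aestronglyMeasurable (by fun_prop))
      hint.ofReal.aestronglyMeasurable
  · filter_upwards [ae_restrict_mem measurableSet_Ioo] with α hα w hw
    rw [norm_mul, norm_mul, Complex.norm_real, Complex.norm_real]
    gcongr
    have hw' : ‖w‖ ≤ ‖w₀‖ + 1 := by
      have := norm_le_norm_add_norm_sub' w w₀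
      have := mem_ball_iff_norm.1 hw
      linarith
    have h1 : ‖α‖ ≤ 1 := by rw [Real.norm_of_nonneg hα.1.le]; exact hα.2.le
    calc _ ≤ Real.exp (‖w₀‖ + 1) * 1 := by gcongr; exact norm_exp_mul_le hα hw'
      _ = _ := mul_one _
  · refine Filter.Eventually.of_forall fun α w _ => ?_
    refine HasDerivAt.mul_const ?_ _
    simpa using ((hasDerivAt_id w).const_mul (α : ℂ)).cexp

theorem expMoment_conj (w : ℂ) :
    expMoment μ (starRingEnd ℂ w) = starRingEnd ℂ (expMoment μ w) := by
  rw [expMoment, expMoment, ← integral_conj]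
  simp [← Complex.exp_conj]

theorem re_expMoment (hint : IntegrableOn μ (Ioo 0 1)) (w : ℂ) :
    (expMoment μ w).re =
      ∫ α in Ioo (0:ℝ) 1, Real.exp (α * w.re) * Real.cos (α * w.im) * μ α := by
  have h := integral_re (integrableOn_expMoment_integrand hint w)
  simp only [RCLike.re_to_complex] at h
  rw [expMoment, ← h]
  simp [Complex.exp_re]

theorem im_expMoment (hint : IntegrableOn μ (Ioo 0 1)) (w : ℂ) :
    (expMoment μ w).im =
      ∫ α in Ioo (0:ℝ) 1, Real.exp (α * w.re) * Real.sin (α * w.im) * μ α := by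
  have h := integral_im (integrableOn_expMoment_integrand hint w)
  simp only [RCLike.im_to_complex] at h
  rw [expMoment, ← h]
  simp [Complex.exp_im]

theorem norm_expMoment_le (hnn : ∀ α ∈ Icc (0:ℝ) 1, 0 ≤ μ α)
    (hf1 : IntegrableOn (fun α => μ α / α) (Ioo 0 1)) {w : ℂ} (hw : w.re < 0) :
    ‖expMoment μ w‖ ≤ (∫ α in Ioo (0:ℝ) 1, μ α / α) / -w.re := by
  rw [← integral_div]
  refine norm_integral_le_of_norm_le (hf1.div_const _) ?_
  filter_upwards [ae_restrict_mem measurableSet_Ioo] with α hα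
  have hμ := hnn α (Ioo_subset_Icc_self hα)
  rw [norm_mul, Complex.norm_real, Complex.norm_exp, Real.norm_of_nonneg hμ]
  have hpos : 0 < α * -w.re := mul_pos hα.1 (by linarith)
  have hexp : Real.exp (α * w.re) ≤ 1 / (α * -w.re) := by
    rw [le_div_iff₀ hpos, ← le_div_iff₀' (Real.exp_pos _), one_div, ← Real.exp_neg]
    have := Real.add_one_le_exp (-(α * w.re))
    linarith
  have hre : (α * w : ℂ).re = α * w.re := by simp
  rw [hre, div_div, div_eq_mul_one_div, mul_comm (μ α)]
  gcongr

theorem sin_pi_mul_le {α y : ℝ} (hα : α ∈ Ioo (0:ℝ) 1) (hy : π / 2 ≤ y) (hy' : y ≤ π) :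
    Real.sin (π * α) / 2 ≤ Real.sin (α * y) := by
  have hπ := Real.pi_pos
  have hs : 0 ≤ Real.sin (π * α) :=
    Real.sin_nonneg_of_nonneg_of_le_pi (by nlinarith [hα.1]) (by nlinarith [hα.2])
  have hy0 : 0 ≤ y := by linarith
  have h := strictConcaveOn_sin_Icc.concaveOn.2
    (⟨le_rfl, hπ.le⟩ : (0:ℝ) ∈ Icc 0 π)
    (⟨by nlinarith [hα.1], by nlinarith [hα.2]⟩ : π * α ∈ Icc 0 π)
    (sub_nonneg.2 ((div_le_one hπ).2 hy')) (div_nonneg hy0 hπ.le) (sub_add_cancel 1 (y / π))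
  have e : y / π * (π * α) = α * y := by field_simp
  simp only [smul_eq_mul, mul_zero, Real.sin_zero, zero_add, e] at h
  have hy2 : 1 / 2 ≤ y / π := by rw [le_div_iff₀ hπ]; linarith
  nlinarith

theorem integral_exp_mul_sin_pos (hnn : ∀ α ∈ Icc (0:ℝ) 1, 0 ≤ μ α)
    (hint : IntegrableOn μ (Ioo 0 1)) (hpos : 0 < ∫ α in Ioo (0:ℝ) 1, μ α) (x : ℝ) :
    0 < ∫ α in Ioo (0:ℝ) 1, Real.exp (α * x) * Real.sin (α * π) * μ α := by
  have hsin : ∀ α ∈ Ioo (0:ℝ) 1, 0 < Real.sin (α * π) := fun α hα =>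
    Real.sin_pos_of_pos_of_lt_pi (by nlinarith [hα.1, Real.pi_pos]) (by nlinarith [hα.2, Real.pi_pos])
  have hμ : 0 ≤ᵐ[volume.restrict (Ioo (0:ℝ) 1)] μ := by
    filter_upwards [ae_restrict_mem measurableSet_Ioo] with α hα
    exact hnn α (Ioo_subset_Icc_self hα)
  rw [setIntegral_pos_iff_support_of_nonneg_ae hμ hint] at hpos
  rw [setIntegral_pos_iff_support_of_nonneg_ae]
  · refine hpos.trans_le (measure_mono fun α hα => ⟨?_, hα.2⟩)
    exact mul_ne_zero (mul_pos (Real.exp_pos _) (hsin α hα.2)).ne' hα.1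
  · filter_upwards [ae_restrict_mem measurableSet_Ioo, hμ] with α hα hμα
    exact mul_nonneg (mul_pos (Real.exp_pos _) (hsin α hα)).le hμα
  · have := (integrableOn_expMoment_integrand hint (x + π * Complex.I)).im
    refine this.congr (Filter.Eventually.of_forall fun α => ?_)
    simp [Complex.exp_im]

theorem exists_le_norm_add_expMoment {lam : ℝ} (hlam : 0 < lam)
    (hnn : ∀ α ∈ Icc (0:ℝ) 1, 0 ≤ μ α) (hint : IntegrableOn μ (Ioo 0 1))
    (hpos : 0 < ∫ α in Ioo (0:ℝ) 1, μ α)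
    (hf1 : IntegrableOn (fun α => μ α / α) (Ioo 0 1)) :
    ∃ c > 0, ∀ w : ℂ, |w.im| ≤ π → c ≤ ‖(lam : ℂ) + expMoment μ w‖ := by
  set A := ∫ α in Ioo (0:ℝ) 1, μ α / α
  have hA : 0 ≤ A := setIntegral_nonneg measurableSet_Ioo fun α hα =>
    div_nonneg (hnn α (Ioo_subset_Icc_self hα)) hα.1.le
  set X := 2 * A / lam + 1
  have hX : 0 < X := by positivity
  set s := ∫ α in Ioo (0:ℝ) 1, Real.exp (α * (-X)) * Real.sin (α * π) * μ α
  have hs : 0 < s := integral_exp_mul_sin_pos hnn hint hpos _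
  have hsint : IntegrableOn (fun α => Real.exp (α * (-X)) * Real.sin (α * π) * μ α)
      (Ioo (0:ℝ) 1) := by
    have := (integrableOn_expMoment_integrand hint ((-X : ℝ) + π * Complex.I)).im
    refine this.congr (Filter.Eventually.of_forall fun α => ?_)
    simp [Complex.exp_im]
  have key : ∀ w : ℂ, 0 ≤ w.im → w.im ≤ π →
      min (lam / 2) (s / 2) ≤ ‖(lam : ℂ) + expMoment μ w‖ := by
    intro w hw0 hwπ
    rcases le_or_gt w.re (-X) with hx | hx
    · have h1 := norm_expMoment_le hnn hf1 (w := w) (by linarith)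
      have h2 : A / -w.re ≤ lam / 2 := by
        rw [div_le_iff₀ (by linarith)]
        have : 2 * A / lam ≤ -w.re := by linarith [show X = 2 * A / lam + 1 from rfl]
        rw [div_le_iff₀ hlam] at this
        linarith
      have h3 := norm_sub_le_norm_add (lam : ℂ) (expMoment μ w)
      rw [Complex.norm_real, Real.norm_of_nonneg hlam.le] at h3
      exact (min_le_left _ _).trans (by linarith)
    rcases le_or_gt w.im (π / 2) with hy | hy
    · have h1 : 0 ≤ (expMoment μ w).re := by
        rw [re_expMoment hint]
        refine setIntegral_nonneg measurableSet_Ioo fun α hα => ?_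
        refine mul_nonneg (mul_nonneg (Real.exp_pos _).le
          (Real.cos_nonneg_of_neg_pi_div_two_le_of_le ?_ ?_)) (hnn α (Ioo_subset_Icc_self hα))
        · nlinarith [hα.1, Real.pi_pos]
        · nlinarith [hα.1, hα.2]
      have h2 := Complex.re_le_norm ((lam : ℂ) + expMoment μ w)
      simp only [Complex.add_re, Complex.ofReal_re] at h2
      exact (min_le_left _ _).trans (by linarith)
    · have h1 : s / 2 ≤ (expMoment μ w).im := by
        rw [im_expMoment hint, ← integral_div]
        refine setIntegral_mono_on (hsint.div_const 2) ?_ measurableSet_Ioo fun α hα => ?_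
        · refine (integrableOn_expMoment_integrand hint w).im.congr
            (Filter.Eventually.of_forall fun α => ?_)
          simp [Complex.exp_im]
        · have hμ := hnn α (Ioo_subset_Icc_self hα)
          have h3 := sin_pi_mul_le hα hy.le hwπ
          have h4 : 0 ≤ Real.sin (π * α) := Real.sin_nonneg_of_nonneg_of_le_pi
            (by nlinarith [hα.1, Real.pi_pos]) (by nlinarith [hα.2, Real.pi_pos])
          calc _ = Real.exp (α * (-X)) * (Real.sin (π * α) / 2) * μ α := by
                rw [mul_comm α π]; ring
            _ ≤ _ := by
              gcongr
              exact hα.1.le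
      have h2 := Complex.abs_im_le_norm ((lam : ℂ) + expMoment μ w)
      simp only [Complex.add_im, Complex.ofReal_im, zero_add] at h2
      exact (min_le_right _ _).trans (h1.trans ((le_abs_self _).trans h2))
  refine ⟨min (lam / 2) (s / 2), by positivity, fun w hw => ?_⟩
  rcases le_total 0 w.im with h | h
  · exact key w h ((le_abs_self _).trans hw)
  · have := key (starRingEnd ℂ w) (by simpa using h) (by
      rw [Complex.conj_im]; exact (neg_le_abs _).trans hw)
    rwa [expMoment_conj, ← Complex.conj_ofReal lam, ← map_add, Complex.norm_conj] at this

end ExpMoment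

section Contour

open Filter Topology

theorem dslope_exp_ne_zero {w w₀ : ℂ} (hw : |w.im| ≤ π) (hw₀ : |w₀.im| < π) :
    dslope Complex.exp w₀ w ≠ 0 := by
  rcases eq_or_ne w w₀ with rfl | hne
  · simp [dslope_same]
  rw [dslope_of_ne _ hne, slope_def_field]
  refine div_ne_zero (fun h => hne ?_) (sub_ne_zero.2 hne)
  obtain ⟨n, hn⟩ := Complex.exp_eq_exp_iff_exists_int.1 (sub_eq_zero.1 h)
  have him : w.im = w₀.im + n * (2 * π) := by
    simpa using congrArg Complex.im hn
  have hπ := Real.pi_pos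
  rw [abs_le] at hw
  rw [abs_lt] at hw₀
  have h1 : (n : ℝ) < 1 := by by_contra! hc; nlinarith
  have h2 : (-1 : ℝ) < n := by by_contra! hc; nlinarith
  have h3 : n = 0 := by
    have h1' : n < 1 := by exact_mod_cast h1
    have h2' : -1 < n := by exact_mod_cast h2
    omega
  simpa [h3] using hn

theorem dslope_div_dslope_exp {Φ : ℂ → ℂ} {w w₀ : ℂ} (hne : w ≠ w₀) :
    dslope Φ w₀ w / dslope Complex.exp w₀ w =
      (Φ w - Φ w₀) / (Complex.exp w - Complex.exp w₀) := by
  rw [dslope_of_ne _ hne, dslope_of_ne _ hne, slope_def_field, slope_def_field,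
    div_div_div_cancel_right₀ (sub_ne_zero.2 hne)]

/-- A form of the Cauchy integral formula, in logarithmic coordinates, for the plane slit along the
negative half-axis. -/
theorem tendsto_integral_jump_div {Φ : ℂ → ℂ} {U : Set ℂ} (hU : IsOpen U)
    (hΦ : DifferentiableOn ℂ Φ U) (hstrip : ∀ w : ℂ, |w.im| ≤ π → w ∈ U) {B : ℝ}
    (hB : ∀ w : ℂ, |w.im| ≤ π → ‖Φ w‖ ≤ B)
    (hlim : ∀ y : ℝ, Tendsto (fun R : ℝ => Φ (((-R : ℝ) : ℂ) + y * Complex.I)) atTop (𝓝 0))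
    {p : ℂ} (hp : 0 < p.re) :
    Tendsto (fun R : ℝ => ∫ x in -R..R,
      (Φ (x + π * Complex.I) - Φ (x + (-π : ℝ) * Complex.I)) / (Complex.exp x + p)) atTop
      (𝓝 (2 * π * Complex.I * (Φ (Complex.log p) / p))) := by
  have hπ := Real.pi_pos
  have hp0 : p ≠ 0 := by rintro rfl; simp at hp
  have hnp : 0 < ‖p‖ := norm_pos_iff.2 hp0
  set w₀ := Complex.log p with hw₀
  have hexp₀ : Complex.exp w₀ = p := Complex.exp_log hp0
  have him₀ : |w₀.im| < π := by
    rw [hw₀, Complex.log_im]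
    exact (Complex.abs_arg_lt_pi_div_two_iff.2 (Or.inl hp)).trans (by linarith)
  have hB0 : 0 ≤ B := (norm_nonneg _).trans (hB w₀ him₀.le)
  set g : ℂ → ℂ := fun w => dslope Φ w₀ w / dslope Complex.exp w₀ w with hg
  have hgval : ∀ {w : ℂ}, w ≠ w₀ → g w = (Φ w - Φ w₀) / (Complex.exp w - p) := fun h => by
    rw [hg, ← hexp₀]; exact dslope_div_dslope_exp h
  have hgdiff : DifferentiableOn ℂ g {w | |w.im| ≤ π} := by
    refine DifferentiableOn.div ?_ ?_ fun w hw => dslope_exp_ne_zero hw him₀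
    · exact ((Complex.differentiableOn_dslope
        (hU.mem_nhds (hstrip _ him₀.le))).2 hΦ).mono hstrip
    · exact ((Complex.differentiableOn_dslope univ_mem).2
        Complex.differentiable_exp.differentiableOn).mono (subset_univ _)
  have hline : ∀ {x y : ℝ}, ((x : ℂ) + y * Complex.I).im = y := by simp
  have hgcont : ∀ x : ℝ, ContinuousOn (fun y : ℝ => g (x + y * Complex.I)) (uIcc (-π) π) := by
    intro x
    refine hgdiff.continuousOn.comp (Continuous.continuousOn (by fun_prop)) fun y hy => ?_
    rw [uIcc_of_le (by linarith)] at hy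
    simpa [abs_le] using hy
  have hnum : ∀ {w : ℂ}, |w.im| ≤ π → ‖Φ w - Φ w₀‖ ≤ 2 * B := fun hw =>
    (norm_sub_le _ _).trans (by linarith [hB _ hw, hB _ him₀.le])
  have hnexp : ∀ x y : ℝ, ‖Complex.exp (x + y * Complex.I)‖ = Real.exp x := fun x y => by
    simp [Complex.norm_exp]
  have hcauchy : ∀ R : ℝ, (∫ x in -R..R,
      (Φ (x + π * Complex.I) - Φ (x + (-π : ℝ) * Complex.I)) / (Complex.exp x + p)) =
      Complex.I * (∫ y in -π..π, g (((-R : ℝ) : ℂ) + y * Complex.I)) -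
        Complex.I * ∫ y in -π..π, g ((R : ℂ) + y * Complex.I) := by
    intro R
    have h := Complex.integral_boundary_rect_eq_zero_of_differentiableOn g
      ⟨-R, -π⟩ ⟨R, π⟩ (hgdiff.mono fun w hw => by
        have := hw.2
        simp only [mem_preimage, uIcc_of_le (show -π ≤ π by linarith)] at this
        exact abs_le.2 this)
    have hcl : ∀ b : ℝ, |b| ≤ π → Continuous fun x : ℝ => g (x + b * Complex.I) := fun b hb =>
      hgdiff.continuousOn.comp_continuous (by fun_prop) fun x => by simpa using hb
    simp only [smul_eq_mul] at h
    rw [← intervalIntegral.integral_sub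
      ((hcl _ (by rw [abs_neg, abs_of_pos hπ])).intervalIntegrable _ _)
      ((hcl _ (by rw [abs_of_pos hπ])).intervalIntegrable _ _)] at h
    rw [sub_eq_zero, ← eq_sub_iff_add_eq] at h
    rw [← h]
    refine intervalIntegral.integral_congr fun x _ => ?_
    have hne : ∀ b : ℝ, |b| = π → (x : ℂ) + b * Complex.I ≠ w₀ := by
      intro b hb h
      rw [← h, hline, hb] at him₀
      exact him₀.false
    have h1 : Complex.exp (x + π * Complex.I) = -Complex.exp x := by
      rw [Complex.exp_add, Complex.exp_pi_mul_I]; ring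
    have h2 : Complex.exp (x + (-π : ℝ) * Complex.I) = -Complex.exp x := by
      rw [Complex.exp_add, Complex.ofReal_neg, neg_mul, Complex.exp_neg_pi_mul_I]; ring
    rw [hgval (hne _ (abs_of_pos hπ)), hgval (hne _ (by rw [abs_neg, abs_of_pos hπ])), h1, h2,
      ← div_sub_div_same, ← neg_add', div_neg, div_neg]
    ring
  have hright : Tendsto (fun R : ℝ => ∫ y in -π..π, g ((R : ℂ) + y * Complex.I)) atTop (𝓝 0) := by
    have hbound : Tendsto (fun R : ℝ => 2 * B / (Real.exp R - ‖p‖) * |π - -π|) atTop (𝓝 0) := by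
      have : Tendsto (fun R : ℝ => Real.exp R - ‖p‖) atTop atTop :=
        tendsto_atTop_add_const_right _ _ Real.tendsto_exp_atTop
      simpa using (this.const_div_atTop (2 * B)).mul_const |π - -π|
    refine squeeze_zero_norm' ?_ hbound
    filter_upwards [Real.tendsto_exp_atTop.eventually_gt_atTop ‖p‖,
      eventually_gt_atTop w₀.re] with R hR hR'
    refine intervalIntegral.norm_integral_le_of_norm_le_const fun y hy => ?_
    rw [uIoc_of_le (by linarith)] at hy
    rw [hgval (by rintro h; rw [← h] at hR'; simp at hR'), norm_div]
    have h1 := norm_sub_norm_le (Complex.exp (R + y * Complex.I)) p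
    rw [hnexp] at h1
    have h2 : 0 < Real.exp R - ‖p‖ := sub_pos.2 hR
    gcongr
    exact hnum (by rw [hline]; exact abs_le.2 ⟨hy.1.le, hy.2⟩)
  have hleft : Tendsto (fun R : ℝ => ∫ y in -π..π, g (((-R : ℝ) : ℂ) + y * Complex.I)) atTop
      (𝓝 (∫ _y in -π..π, Φ w₀ / p)) := by
    have hexpneg : Tendsto (fun R : ℝ => Real.exp (-R)) atTop (𝓝 0) :=
      Real.tendsto_exp_neg_atTop_nhds_zero
    have hne : ∀ᶠ R : ℝ in atTop, ∀ y : ℝ, ((-R : ℝ) : ℂ) + y * Complex.I ≠ w₀ := by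
      filter_upwards [eventually_gt_atTop (-w₀.re)] with R hR y h
      rw [← h] at hR
      simp at hR
    refine intervalIntegral.tendsto_integral_filter_of_dominated_convergence
      (fun _ => 2 * B / (‖p‖ / 2)) ?_ ?_ intervalIntegrable_const ?_
    · exact Eventually.of_forall fun R => ((hgcont (-R)).mono uIoc_subset_uIcc).aestronglyMeasurable
        measurableSet_uIoc
    · filter_upwards [hne, hexpneg.eventually_lt_const (half_pos hnp)] with R hR hR'
      refine Eventually.of_forall fun y hy => ?_
      rw [uIoc_of_le (by linarith)] at hy
      rw [hgval (hR y), norm_div]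
      have h1 := norm_sub_norm_le p (Complex.exp ((-R : ℝ) + y * Complex.I))
      rw [hnexp, norm_sub_rev] at h1
      gcongr
      · exact hnum (by rw [hline]; exact abs_le.2 ⟨hy.1.le, hy.2⟩)
      · linarith
    · refine Eventually.of_forall fun y _ => ?_
      have h1 : Tendsto (fun R : ℝ => Complex.exp (((-R : ℝ) : ℂ) + y * Complex.I)) atTop (𝓝 0) := by
        rw [tendsto_zero_iff_norm_tendsto_zero]
        simpa only [hnexp] using hexpneg
      have h2 := ((hlim y).sub_const (Φ w₀)).div (h1.sub_const p) (by simpa using hp0)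
      simp only [zero_sub, neg_div_neg_eq] at h2
      refine h2.congr' ?_
      filter_upwards [hne] with R hR
      exact (hgval (hR y)).symm
  have h := (hleft.const_mul Complex.I).sub (hright.const_mul Complex.I)
  rw [intervalIntegral.integral_const] at h
  refine (h.congr fun R => (hcauchy R).symm).trans (le_of_eq ?_)
  congr 1
  rw [Complex.real_smul]
  push_cast
  ring

end Contour

section Laplace

open Filter Topology

variable {μ : ℝ → ℝ} {lam : ℝ}

theorem im_div_add_ofReal (z : ℂ) (a : ℝ) :
    (z / (z + a)).im = a * (z.im / ((a + z.re) ^ 2 + z.im ^ 2)) := by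
  simp only [Complex.div_im, Complex.normSq_apply, Complex.add_re, Complex.add_im,
    Complex.ofReal_re, Complex.ofReal_im, add_zero]
  rw [← sub_div, mul_div_assoc']
  congr 1 <;> ring

theorem Gfun_exp (hint : IntegrableOn μ (Ioo 0 1)) (x : ℝ) :
    Gfun μ lam (Real.exp x) = (expMoment μ (x + π * Complex.I)).im /
      ((lam + (expMoment μ (x + π * Complex.I)).re) ^ 2 +
        (expMoment μ (x + π * Complex.I)).im ^ 2) := by
  rw [re_expMoment hint, im_expMoment hint]
  simp [Gfun, ← Real.exp_mul, mul_comm]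

theorem Gfun_exp_nonneg (hnn : ∀ α ∈ Icc (0:ℝ) 1, 0 ≤ μ α) (hint : IntegrableOn μ (Ioo 0 1))
    (hpos : 0 < ∫ α in Ioo (0:ℝ) 1, μ α) (x : ℝ) : 0 ≤ Gfun μ lam (Real.exp x) := by
  rw [Gfun_exp hint]
  refine div_nonneg ?_ (by positivity)
  rw [im_expMoment hint]
  simpa using (integral_exp_mul_sin_pos hnn hint hpos x).le

theorem jump_expMoment_div (hint : IntegrableOn μ (Ioo 0 1)) (x : ℝ) :
    expMoment μ (x + π * Complex.I) / (expMoment μ (x + π * Complex.I) + lam) -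
      expMoment μ (x + (-π : ℝ) * Complex.I) / (expMoment μ (x + (-π : ℝ) * Complex.I) + lam) =
    2 * Complex.I * lam * Gfun μ lam (Real.exp x) := by
  have hconj : (x : ℂ) + (-π : ℝ) * Complex.I = starRingEnd ℂ (x + π * Complex.I) := by simp
  rw [hconj, expMoment_conj]
  conv_lhs => rw [← Complex.conj_ofReal lam, ← map_add, ← map_div₀, Complex.conj_ofReal]
  rw [Complex.sub_conj, im_div_add_ofReal, ← Gfun_exp hint]
  push_cast
  ring

theorem continuous_Gfun_exp (hnn : ∀ α ∈ Icc (0:ℝ) 1, 0 ≤ μ α)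
    (hint : IntegrableOn μ (Ioo 0 1)) (hpos : 0 < ∫ α in Ioo (0:ℝ) 1, μ α) :
    Continuous fun x => Gfun μ lam (Real.exp x) := by
  have hc : Continuous fun x : ℝ => expMoment μ (x + π * Complex.I) :=
    (differentiable_expMoment hint).continuous.comp (by fun_prop)
  simp_rw [Gfun_exp hint]
  refine Continuous.div (by fun_prop) (by fun_prop) fun x => ?_
  have : 0 < (expMoment μ (x + π * Complex.I)).im := by
    rw [im_expMoment hint]
    simpa using integral_exp_mul_sin_pos hnn hint hpos x
  positivity

theorem tendsto_integral_Gfun_exp (hlam : 0 < lam) (hnn : ∀ α ∈ Icc (0:ℝ) 1, 0 ≤ μ α)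
    (hint : IntegrableOn μ (Ioo 0 1)) (hpos : 0 < ∫ α in Ioo (0:ℝ) 1, μ α)
    (hf1 : IntegrableOn (fun α => μ α / α) (Ioo 0 1)) {p : ℂ} (hp : 0 < p.re) :
    Tendsto (fun R : ℝ => ∫ x in -R..R, (Gfun μ lam (Real.exp x) : ℂ) / (Complex.exp x + p)) atTop
      (𝓝 (π / lam * (expMoment μ (Complex.log p) /
        (p * (expMoment μ (Complex.log p) + lam))))) := by
  obtain ⟨c, hc, hcle⟩ := exists_le_norm_add_expMoment hlam hnn hint hpos hf1
  have hdiff := differentiable_expMoment hint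
  have hne : ∀ w : ℂ, |w.im| ≤ π → expMoment μ w + lam ≠ 0 := fun w hw => by
    rw [add_comm]; exact norm_pos_iff.1 (hc.trans_le (hcle w hw))
  have hU : IsOpen {w : ℂ | expMoment μ w + lam ≠ 0} :=
    isOpen_ne_fun (hdiff.continuous.add continuous_const) continuous_const
  have hlamC : (lam : ℂ) ≠ 0 := by exact_mod_cast hlam.ne'
  have h := tendsto_integral_jump_div (Φ := fun w => expMoment μ w / (expMoment μ w + lam)) hU
    (hdiff.differentiableOn.div (hdiff.differentiableOn.add_const _) fun w hw => hw) hne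
    (B := 1 + lam / c) (fun w hw => ?_) (fun y => ?_) hp
  · simp only [jump_expMoment_div hint] at h
    have h2 := h.const_mul (2 * Complex.I * lam : ℂ)⁻¹
    refine (h2.congr fun R => ?_).trans (le_of_eq ?_)
    · rw [← intervalIntegral.integral_const_mul]
      refine intervalIntegral.integral_congr fun x _ => ?_
      have := Complex.I_ne_zero
      field_simp
    · congr 1
      have := Complex.I_ne_zero
      have hp0 : p ≠ 0 := by rintro rfl; simp at hp
      rw [div_div, mul_comm p]
      field_simp
  · have h1 : expMoment μ w / (expMoment μ w + lam) = 1 - lam / (expMoment μ w + lam) := by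
      rw [eq_sub_iff_add_eq, ← add_div, div_self (hne w hw)]
    rw [h1]
    refine (norm_sub_le _ _).trans ?_
    rw [norm_one, norm_div, Complex.norm_real, Real.norm_of_nonneg hlam.le, add_comm (expMoment μ w)]
    gcongr
    exact hcle w hw
  · have h0 : Tendsto (fun R : ℝ => expMoment μ (((-R : ℝ) : ℂ) + y * Complex.I)) atTop (𝓝 0) := by
      refine squeeze_zero_norm' ?_
        (tendsto_id.const_div_atTop (∫ α in Ioo (0:ℝ) 1, μ α / α) :
          Tendsto (fun R : ℝ => _ / R) atTop (𝓝 0))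
      filter_upwards [eventually_gt_atTop 0] with R hR
      simpa using norm_expMoment_le hnn hf1 (w := ((-R : ℝ) : ℂ) + y * Complex.I) (by simpa using hR)
    have h1 := h0.div (h0.add_const (lam : ℂ)) (by simpa using hlamC)
    rwa [zero_div] at h1

theorem integrable_Gfun_exp (hlam : 0 < lam) (hnn : ∀ α ∈ Icc (0:ℝ) 1, 0 ≤ μ α)
    (hint : IntegrableOn μ (Ioo 0 1)) (hpos : 0 < ∫ α in Ioo (0:ℝ) 1, μ α)
    (hf1 : IntegrableOn (fun α => μ α / α) (Ioo 0 1)) {a : ℝ} (ha : 0 < a) :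
    Integrable fun x => Gfun μ lam (Real.exp x) / (Real.exp x + a) := by
  have hcont : Continuous fun x => Gfun μ lam (Real.exp x) / (Real.exp x + a) :=
    (continuous_Gfun_exp hnn hint hpos).div (by fun_prop) fun x => by positivity
  have h := tendsto_integral_Gfun_exp hlam hnn hint hpos hf1 (p := a) (by simpa using ha)
  refine integrable_of_intervalIntegral_norm_tendsto _ (fun R => hcont.integrableOn_Ioc)
    tendsto_neg_atTop_atBot tendsto_id (((Complex.continuous_re.tendsto _).comp h).congr fun R => ?_)
  have h1 : ∀ x : ℝ, (Gfun μ lam (Real.exp x) : ℂ) / (Complex.exp x + a) =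
      ((Gfun μ lam (Real.exp x) / (Real.exp x + a) : ℝ) : ℂ) := fun x => by push_cast; rfl
  simp only [Function.comp_apply, h1, intervalIntegral.integral_ofReal, Complex.ofReal_re, id]
  refine intervalIntegral.integral_congr fun x _ => (Real.norm_of_nonneg ?_).symm
  have := Gfun_exp_nonneg (lam := lam) hnn hint hpos x
  positivity

theorem integral_Gfun_exp (hlam : 0 < lam) (hnn : ∀ α ∈ Icc (0:ℝ) 1, 0 ≤ μ α)
    (hint : IntegrableOn μ (Ioo 0 1)) (hpos : 0 < ∫ α in Ioo (0:ℝ) 1, μ α)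
    (hf1 : IntegrableOn (fun α => μ α / α) (Ioo 0 1)) {p : ℂ} (hp : 0 < p.re) :
    ∫ x : ℝ, (Gfun μ lam (Real.exp x) : ℂ) / (Complex.exp x + p) =
      π / lam * (expMoment μ (Complex.log p) / (p * (expMoment μ (Complex.log p) + lam))) := by
  have hre : ∀ x : ℝ, Real.exp x + p.re ≤ ‖Complex.exp x + p‖ := fun x => by
    simpa [Complex.exp_ofReal_re] using Complex.re_le_norm (Complex.exp x + p)
  have hpos' : ∀ x : ℝ, 0 < Real.exp x + p.re := fun x => by positivity
  have hcont : Continuous fun x : ℝ => (Gfun μ lam (Real.exp x) : ℂ) / (Complex.exp x + p) :=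
    (Complex.continuous_ofReal.comp (continuous_Gfun_exp hnn hint hpos)).div (by fun_prop)
      fun x => norm_pos_iff.1 ((hpos' x).trans_le (hre x))
  have hi : Integrable fun x : ℝ => (Gfun μ lam (Real.exp x) : ℂ) / (Complex.exp x + p) := by
    refine (integrable_Gfun_exp hlam hnn hint hpos hf1 hp).mono' hcont.aestronglyMeasurable
      (Eventually.of_forall fun x => ?_)
    have hG := Gfun_exp_nonneg (lam := lam) hnn hint hpos x
    rw [norm_div, Complex.norm_real, Real.norm_of_nonneg hG]
    gcongr
    exact hre x
  exact tendsto_nhds_unique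
    (intervalIntegral_tendsto_integral hi tendsto_neg_atTop_atBot tendsto_id)
    (tendsto_integral_Gfun_exp hlam hnn hint hpos hf1 hp)

theorem integrableOn_Gfun_div (hlam : 0 < lam) (hnn : ∀ α ∈ Icc (0:ℝ) 1, 0 ≤ μ α)
    (hint : IntegrableOn μ (Ioo 0 1)) (hpos : 0 < ∫ α in Ioo (0:ℝ) 1, μ α)
    (hf1 : IntegrableOn (fun α => μ α / α) (Ioo 0 1)) {a : ℝ} (ha : 0 < a) :
    IntegrableOn (fun r => Gfun μ lam r / r / (r + a)) (Ioi 0) := by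
  rw [← Real.range_exp, ← image_univ, integrableOn_image_iff_integrableOn_abs_deriv_smul
    MeasurableSet.univ (fun x _ => (Real.hasDerivAt_exp x).hasDerivWithinAt)
    Real.exp_injective.injOn, integrableOn_univ]
  refine (integrable_Gfun_exp hlam hnn hint hpos hf1 ha).congr (Eventually.of_forall fun x => ?_)
  have := Real.exp_pos x
  simp only [abs_of_pos this, smul_eq_mul]
  field_simp

theorem integral_Gfun_div (hlam : 0 < lam) (hnn : ∀ α ∈ Icc (0:ℝ) 1, 0 ≤ μ α)
    (hint : IntegrableOn μ (Ioo 0 1)) (hpos : 0 < ∫ α in Ioo (0:ℝ) 1, μ α)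
    (hf1 : IntegrableOn (fun α => μ α / α) (Ioo 0 1)) {p : ℂ} (hp : 0 < p.re) :
    ∫ r in Ioi (0:ℝ), ((Gfun μ lam r / r : ℝ) : ℂ) / (r + p) =
      π / lam * (expMoment μ (Complex.log p) / (p * (expMoment μ (Complex.log p) + lam))) := by
  rw [← Real.range_exp, ← image_univ, integral_image_eq_integral_abs_deriv_smul
    MeasurableSet.univ (fun x _ => (Real.hasDerivAt_exp x).hasDerivWithinAt)
    Real.exp_injective.injOn, setIntegral_univ, ← integral_Gfun_exp hlam hnn hint hpos hf1 hp]
  refine integral_congr_ae (Eventually.of_forall fun x => ?_)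
  simp only [abs_of_pos (Real.exp_pos x), Complex.real_smul]
  push_cast
  have := Complex.exp_ne_zero x
  rw [← mul_div_assoc, mul_div_cancel₀ _ this]

theorem aestronglyMeasurable_Gfun (hnn : ∀ α ∈ Icc (0:ℝ) 1, 0 ≤ μ α)
    (hint : IntegrableOn μ (Ioo 0 1)) (hpos : 0 < ∫ α in Ioo (0:ℝ) 1, μ α) :
    AEStronglyMeasurable (Gfun μ lam) (volume.restrict (Ioi 0)) := by
  refine ContinuousOn.aestronglyMeasurable ?_ measurableSet_Ioi
  have h : ContinuousOn (fun r => Gfun μ lam (Real.exp (Real.log r))) (Ioi 0) :=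
    (continuous_Gfun_exp hnn hint hpos).comp_continuousOn
      (Real.continuousOn_log.mono fun r hr => (mem_Ioi.1 hr).ne')
  exact h.congr fun r hr => by simp only [Real.exp_log hr]

/-- The Laplace transform of a Laplace transform is a Stieltjes transform. -/
theorem integral_exp_mul_integral_exp_mul {h : ℝ → ℝ} {p : ℂ} (hp : 0 < p.re)
    (hmeas : AEStronglyMeasurable h (volume.restrict (Ioi 0)))
    (hint : IntegrableOn (fun r => h r / (r + p.re)) (Ioi 0)) :
    ∫ t in Ioi (0:ℝ), Complex.exp (-p * t) * ((∫ r in Ioi (0:ℝ), Real.exp (-r * t) * h r : ℝ) : ℂ) =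
      ∫ r in Ioi (0:ℝ), (h r : ℂ) / (r + p) := by
  have hre : ∀ r ∈ Ioi (0:ℝ), (-(r + p) : ℂ).re < 0 := fun r hr => by
    simp only [Complex.neg_re, Complex.add_re, Complex.ofReal_re, neg_lt_zero]
    exact add_pos hr hp
  have hF : ∀ t r : ℝ, Complex.exp (-p * t) * ((Real.exp (-r * t) * h r : ℝ) : ℂ) =
      Complex.exp (-(r + p) * t) * h r := fun t r => by
    push_cast
    rw [← mul_assoc, ← Complex.exp_add]
    congr 2
    ring
  have hnorm : ∀ t r : ℝ, ‖Complex.exp (-(r + p) * t) * h r‖ =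
      Real.exp (-(r + p.re) * t) * |h r| := fun t r => by
    simp [Complex.norm_exp]
  have hprod : Integrable (Function.uncurry fun t r : ℝ => Complex.exp (-(r + p) * t) * (h r : ℂ))
      ((volume.restrict (Ioi (0:ℝ))).prod (volume.restrict (Ioi (0:ℝ)))) := by
    refine (integrable_prod_iff' ?_).2 ⟨?_, ?_⟩
    · exact AEStronglyMeasurable.mul (Continuous.aestronglyMeasurable (by fun_prop))
        (Complex.continuous_ofReal.comp_aestronglyMeasurable hmeas).comp_snd
    · filter_upwards [ae_restrict_mem measurableSet_Ioi] with r hr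
      exact (integrableOn_exp_mul_complex_Ioi (hre r hr) 0).mul_const (h r : ℂ)
    · refine hint.norm.congr ?_
      filter_upwards [ae_restrict_mem measurableSet_Ioi] with r hr
      have hrp : 0 < r + p.re := add_pos hr hp
      simp only [Function.uncurry_apply_pair, hnorm]
      rw [integral_mul_const, integral_exp_mul_Ioi (by linarith), norm_div, Real.norm_eq_abs,
        Real.norm_of_nonneg hrp.le]
      simp only [mul_zero, Real.exp_zero, neg_div_neg_eq]
      ring
  calc _ = ∫ t in Ioi (0:ℝ), ∫ r in Ioi (0:ℝ), Complex.exp (-(r + p) * t) * (h r : ℂ) := by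
        refine integral_congr_ae (Eventually.of_forall fun t => ?_)
        simp only [← integral_complex_ofReal, ← integral_const_mul, hF]
    _ = ∫ r in Ioi (0:ℝ), ∫ t in Ioi (0:ℝ), Complex.exp (-(r + p) * t) * (h r : ℂ) :=
        integral_integral_swap hprod
    _ = _ := by
        refine setIntegral_congr_fun measurableSet_Ioi fun r hr => ?_
        rw [integral_mul_const, integral_exp_mul_complex_Ioi (hre r hr)]
        simp only [Complex.ofReal_zero, mul_zero, Complex.exp_zero, neg_div_neg_eq]
        ring

end Laplace

/-- the Laplace transform of `v` given by (postacv) equals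
`v₀ (∫₀¹ p^α μ(α) dα) / (p [∫₀¹ p^α μ(α) dα + λ])` on the right half-plane. -/
theorem laplace_of_v (μ : ℝ → ℝ) (lam v₀ : ℝ) (hlam : 0 < lam)
    (hmeas : Measurable μ)
    (hnn : ∀ α ∈ Icc (0:ℝ) 1, 0 ≤ μ α)
    (hint : IntegrableOn μ (Ioo 0 1))
    (hpos : 0 < ∫ α in Ioo (0:ℝ) 1, μ α)
    (hf1 : IntegrableOn (fun α => μ α / α) (Ioo 0 1)) :
    ∀ p : ℂ, 0 < p.re →
      (∫ t in Ioi (0:ℝ), Complex.exp (-p * t) * (vfun μ lam v₀ t : ℂ)) =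
        (v₀ : ℂ) * (∫ α in Ioo (0:ℝ) 1, p ^ (α : ℂ) * (μ α : ℂ)) /
          (p * ((∫ α in Ioo (0:ℝ) 1, p ^ (α : ℂ) * (μ α : ℂ)) + (lam : ℂ))) := by
  intro p hp
  have hp0 : p ≠ 0 := by rintro rfl; simp at hp
  have hM : ∫ α in Ioo (0:ℝ) 1, p ^ (α : ℂ) * (μ α : ℂ) = expMoment μ (Complex.log p) := by
    simp only [expMoment, Complex.cpow_def_of_ne_zero hp0, mul_comm]
  have hv : ∀ t : ℝ, Complex.exp (-p * t) * (vfun μ lam v₀ t : ℂ) =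
      (v₀ * (lam / π) : ℂ) * (Complex.exp (-p * t) *
        ((∫ r in Ioi (0:ℝ), Real.exp (-r * t) * (Gfun μ lam r / r) : ℝ) : ℂ)) := fun t => by
    simp only [vfun, div_mul_eq_mul_div, mul_div_assoc]
    push_cast
    ring
  have hmeasG : AEStronglyMeasurable (fun r => Gfun μ lam r / r) (volume.restrict (Ioi 0)) :=
    ((aestronglyMeasurable_Gfun hnn hint hpos).aemeasurable.div
      measurable_id.aemeasurable).aestronglyMeasurable
  simp only [hv]
  rw [integral_const_mul, integral_exp_mul_integral_exp_mul hp hmeasG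
    (integrableOn_Gfun_div hlam hnn hint hpos hf1 hp),
    integral_Gfun_div hlam hnn hint hpos hf1 hp, hM]
  have h1 : (lam : ℂ) ≠ 0 := by exact_mod_cast hlam.ne'
  have h2 : (π : ℂ) ≠ 0 := by exact_mod_cast Real.pi_ne_zero
  rw [← mul_assoc, mul_div_assoc]
  congr 1
  field_simp
end

section
/- Assume λ > 0 and μ satisfies (aa) and (f1). Then (λ/π) ∫₀^∞ (1/r) · (∫₀¹ r^α sin(πα) μ(α) dα) / [ (λ + ∫₀¹ r^α cos(πα) μ(α) dα)² + (∫₀¹ r^α sin(πα) μ(α) dα)² ] dr = 1. -/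
open MeasureTheory Set Real

section LaplaceTransform

open ProbabilityTheory Filter Topology Complex

variable {ν : Measure ℝ} [IsFiniteMeasure ν]

lemma integrable_of_continuous_of_ae_mem_Ioo {E : Type*} [NormedAddCommGroup E]
    [SecondCountableTopology E]
    (hν : ∀ᵐ a ∂ν, a ∈ Ioo (0:ℝ) 1) {f : ℝ → E} (hf : Continuous f) : Integrable f ν := by
  borelize E
  obtain ⟨C, hC⟩ := (isCompact_Icc (a := (0:ℝ)) (b := 1)).exists_bound_of_continuousOn
    hf.continuousOn
  exact Integrable.of_bound hf.aestronglyMeasurable C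
    (hν.mono fun a ha => hC a (Ioo_subset_Icc_self ha))

lemma differentiable_complexMGF_id (hν : ∀ᵐ a ∂ν, a ∈ Ioo (0:ℝ) 1) :
    Differentiable ℂ (complexMGF id ν) := by
  have h : integrableExpSet id ν = univ := by
    refine eq_univ_of_forall fun t => ?_
    exact integrable_of_continuous_of_ae_mem_Ioo hν (f := fun a => rexp (t * id a)) (by fun_prop)
  intro z
  exact (hasDerivAt_complexMGF (by simp [h])).differentiableAt

lemma re_complexMGF_id (hν : ∀ᵐ a ∂ν, a ∈ Ioo (0:ℝ) 1) (z : ℂ) :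
    (complexMGF id ν z).re = ∫ a, rexp (z.re * a) * Real.cos (z.im * a) ∂ν := by
  have h := integrable_of_continuous_of_ae_mem_Ioo hν (f := fun a : ℝ => cexp (z * a))
    (by fun_prop)
  simp only [complexMGF, id]
  rw [← reCLM_apply, ← reCLM.integral_comp_comm h]
  simp [Complex.exp_re]

lemma im_complexMGF_id (hν : ∀ᵐ a ∂ν, a ∈ Ioo (0:ℝ) 1) (z : ℂ) :
    (complexMGF id ν z).im = ∫ a, rexp (z.re * a) * Real.sin (z.im * a) ∂ν := by
  have h := integrable_of_continuous_of_ae_mem_Ioo hν (f := fun a : ℝ => cexp (z * a))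
    (by fun_prop)
  simp only [complexMGF, id]
  rw [← imCLM_apply, ← imCLM.integral_comp_comm h]
  simp [Complex.exp_im]

lemma mul_one_sub_le_cos {a t : ℝ} (ha : a ∈ Ioo (0:ℝ) 1) (ht : t ∈ Icc 0 (π / 2)) :
    a * (1 - a) ≤ Real.cos (t * a) := by
  obtain ⟨h0, h1⟩ := ha
  obtain ⟨t0, t1⟩ := ht
  have hta : t * a ≤ π / 2 * a := by gcongr
  have hta0 : 0 ≤ t * a := by positivity
  have hpa : π / 2 * a ≤ π / 2 := by nlinarith [pi_pos]
  have h := Real.mul_le_sin (x := π / 2 - t * a) (by linarith) (by linarith)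
  rw [Real.sin_pi_div_two_sub] at h
  have h2 : 2 / π * (π / 2 - π / 2 * a) = 1 - a := by field_simp
  have h3 : 2 / π * (π / 2 - π / 2 * a) ≤ 2 / π * (π / 2 - t * a) := by gcongr
  nlinarith

lemma mul_one_sub_le_sin {a t : ℝ} (ha : a ∈ Ioo (0:ℝ) 1) (ht : t ∈ Icc (π / 2) π) :
    a * (1 - a) ≤ Real.sin (t * a) := by
  obtain ⟨h0, h1⟩ := ha
  obtain ⟨t0, t1⟩ := ht
  have hta : t * a ≤ π * a := by gcongr
  have hta' : π / 2 * a ≤ t * a := by gcongr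
  have hpa : 0 < π * a := by positivity
  rcases le_total (t * a) (π / 2) with hc | hc
  · have h := Real.mul_le_sin (x := t * a) (by linarith) hc
    have h2 : 2 / π * (π / 2 * a) = a := by field_simp
    have h3 : 2 / π * (π / 2 * a) ≤ 2 / π * (t * a) := by gcongr
    nlinarith
  · have h := Real.mul_le_sin (x := π - t * a) (by nlinarith [pi_pos]) (by linarith)
    rw [Real.sin_pi_sub] at h
    have h2 : 2 / π * (π - π * a) = 2 * (1 - a) := by field_simp
    have h3 : 2 / π * (π - π * a) ≤ 2 / π * (π - t * a) := by gcongr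
    nlinarith

lemma integral_le_norm_add_complexMGF_id (hν : ∀ᵐ a ∂ν, a ∈ Ioo (0:ℝ) 1) {lam : ℝ}
    (hlam : 0 ≤ lam) {z : ℂ} (hz : z.im ∈ Icc 0 π) :
    ∫ a, rexp (z.re * a) * (a * (1 - a)) ∂ν ≤ ‖(lam : ℂ) + complexMGF id ν z‖ := by
  have hm := integrable_of_continuous_of_ae_mem_Ioo hν
    (f := fun a => rexp (z.re * a) * (a * (1 - a))) (by fun_prop)
  rcases le_total z.im (π / 2) with h | h
  · refine le_trans ?_ (re_le_norm _)
    rw [add_re, ofReal_re, re_complexMGF_id hν]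
    refine le_add_of_nonneg_of_le hlam (integral_mono_ae hm
      (integrable_of_continuous_of_ae_mem_Ioo hν (by fun_prop)) ?_)
    filter_upwards [hν] with a ha
    have := mul_one_sub_le_cos ha ⟨hz.1, h⟩
    gcongr
  · refine le_trans ?_ ((le_abs_self _).trans (abs_im_le_norm _))
    rw [add_im, ofReal_im, zero_add, im_complexMGF_id hν]
    refine integral_mono_ae hm
      (integrable_of_continuous_of_ae_mem_Ioo hν (by fun_prop)) ?_
    filter_upwards [hν] with a ha
    have := mul_one_sub_le_sin ha ⟨h, hz.2⟩
    gcongr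

lemma integral_pos_of_pos_on_Ioo [NeZero ν] (hν : ∀ᵐ a ∂ν, a ∈ Ioo (0:ℝ) 1) {f : ℝ → ℝ}
    (hf : Continuous f) (hpos : ∀ a ∈ Ioo (0:ℝ) 1, 0 < f a) : 0 < ∫ a, f a ∂ν := by
  have hae : ∀ᵐ a ∂ν, 0 < f a := hν.mono hpos
  rw [integral_pos_iff_support_of_nonneg_ae (hae.mono fun a ha => ha.le)
    (integrable_of_continuous_of_ae_mem_Ioo hν hf)]
  have : Function.support f =ᵐ[ν] univ := by
    rw [eventuallyEq_univ]
    exact hae.mono fun a ha => ha.ne'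
  rw [measure_congr this]
  exact NeZero.pos _

lemma mul_integral_le_integral_exp_mul (hν : ∀ᵐ a ∂ν, a ∈ Ioo (0:ℝ) 1) (x : ℝ) :
    x * ∫ a, a * (a * (1 - a)) ∂ν ≤ ∫ a, rexp (x * a) * (a * (1 - a)) ∂ν := by
  rw [← integral_const_mul]
  refine integral_mono_ae (integrable_of_continuous_of_ae_mem_Ioo hν (by fun_prop))
    (integrable_of_continuous_of_ae_mem_Ioo hν (by fun_prop)) ?_
  filter_upwards [hν] with a ha
  have h1 : x * a ≤ rexp (x * a) := by linarith [Real.add_one_le_exp (x * a)]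
  have h2 : 0 ≤ a * (1 - a) := mul_nonneg ha.1.le (by linarith [ha.2])
  calc x * (a * (a * (1 - a))) = x * a * (a * (1 - a)) := by ring
    _ ≤ _ := by gcongr

lemma tendsto_mgf_id_atBot (hν : ∀ᵐ a ∂ν, a ∈ Ioo (0:ℝ) 1) :
    Tendsto (mgf id ν) atBot (𝓝 0) := by
  rw [← integral_zero ℝ ℝ (μ := ν)]
  refine tendsto_integral_filter_of_dominated_convergence (fun _ => 1)
    (.of_forall fun x => by fun_prop) ?_ (integrable_const _) ?_
  · filter_upwards [eventually_le_atBot 0] with x hx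
    filter_upwards [hν] with a ha
    simpa using mul_nonpos_of_nonpos_of_nonneg hx ha.1.le
  · filter_upwards [hν] with a ha
    exact Real.tendsto_exp_atBot.comp (tendsto_id.atBot_mul_const ha.1)

lemma tendsto_intervalIntegral_of_norm_sub_le {f : ℝ → ℝ → ℂ} {b : ℝ → ℝ} {c : ℂ} {T : ℝ}
    (hT : 0 ≤ T) (hf : ∀ R, ContinuousOn (f R) (Icc 0 T))
    (hfb : ∀ᶠ R in atTop, ∀ t ∈ Icc 0 T, ‖f R t - c‖ ≤ b R) (hb : Tendsto b atTop (𝓝 0)) :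
    Tendsto (fun R => ∫ t in (0:ℝ)..T, f R t) atTop (𝓝 (T * c)) := by
  rw [tendsto_iff_norm_sub_tendsto_zero]
  have hb' : Tendsto (fun R => b R * |T - 0|) atTop (𝓝 0) := by
    simpa using hb.mul_const |T - 0|
  refine tendsto_of_tendsto_of_tendsto_of_le_of_le' tendsto_const_nhds hb'
    (.of_forall fun R => norm_nonneg _) ?_
  filter_upwards [hfb] with R hR
  have h : (T : ℂ) * c = ∫ t in (0:ℝ)..T, c := by simp
  rw [h, ← intervalIntegral.integral_sub]
  · refine intervalIntegral.norm_integral_le_of_norm_le_const fun t ht => hR t ?_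
    rw [uIoc_of_le hT] at ht
    exact Ioc_subset_Icc_self ht
  · exact ContinuousOn.intervalIntegrable (by rw [uIcc_of_le hT]; exact hf R)
  · simp

lemma add_complexMGF_id_ne_zero [NeZero ν] (hν : ∀ᵐ a ∂ν, a ∈ Ioo (0:ℝ) 1) {lam : ℝ}
    (hlam : 0 ≤ lam) {z : ℂ} (hz : z.im ∈ Icc 0 π) : (lam : ℂ) + complexMGF id ν z ≠ 0 := by
  rw [← norm_pos_iff]
  refine lt_of_lt_of_le (integral_pos_of_pos_on_Ioo hν (by fun_prop) fun a ha => ?_)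
    (integral_le_norm_add_complexMGF_id hν hlam hz)
  exact mul_pos (Real.exp_pos _) (mul_pos ha.1 (by linarith [ha.2]))

/-- The imaginary part, along the upper edge `Im z = π`, of the contour integral of
`1 / (lam + ∫ exp (z a) dν(a))`. -/
lemma tendsto_integral_im_inv_add_complexMGF [NeZero ν] (hν : ∀ᵐ a ∂ν, a ∈ Ioo (0:ℝ) 1)
    {lam : ℝ} (hlam : 0 < lam) :
    Tendsto (fun R : ℝ => ∫ x in (-R)..R, -((lam : ℂ) + complexMGF id ν (x + π * I))⁻¹.im)
      atTop (𝓝 (π / lam)) := by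
  set F : ℂ → ℂ := fun z => ((lam : ℂ) + complexMGF id ν z)⁻¹ with hF
  have hd : DifferentiableOn ℂ F {z | z.im ∈ Icc 0 π} := fun z hz =>
    (((differentiable_complexMGF_id hν z).const_add _).inv
      (add_complexMGF_id_ne_zero hν hlam.le hz)).differentiableWithinAt
  have hvert (R : ℝ) : ContinuousOn (fun t : ℝ => F (R + t * I)) (Icc 0 π) :=
    hd.continuousOn.comp (by fun_prop) fun t ht => by simpa using ht
  have hhor {s : ℝ} (hs : s ∈ Icc 0 π) : Continuous (fun x : ℝ => F (x + s * I)) :=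
    hd.continuousOn.comp_continuous (by fun_prop) fun x => by simpa using hs
  have hright : Tendsto (fun R : ℝ => ∫ t in (0:ℝ)..π, F (R + t * I)) atTop (𝓝 (π * 0)) := by
    set K := ∫ a, a * (a * (1 - a)) ∂ν
    have hK : 0 < K := integral_pos_of_pos_on_Ioo hν (by fun_prop) fun a ha =>
      mul_pos ha.1 (mul_pos ha.1 (by linarith [ha.2]))
    refine tendsto_intervalIntegral_of_norm_sub_le (b := fun R => (R * K)⁻¹) pi_pos.le hvert ?_
      (tendsto_inv_atTop_zero.comp (tendsto_id.atTop_mul_const hK))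
    filter_upwards [eventually_gt_atTop 0] with R hR t ht
    rw [sub_zero, hF, norm_inv]
    have hz : ((R : ℂ) + t * I).im ∈ Icc 0 π := by simpa using ht
    have h := (mul_integral_le_integral_exp_mul hν _).trans
      (integral_le_norm_add_complexMGF_id hν hlam.le hz)
    have hre : ((R : ℂ) + t * I).re = R := by simp
    rw [hre] at h
    have : 0 < R * K := by positivity
    gcongr
  have hleft : Tendsto (fun R : ℝ => ∫ t in (0:ℝ)..π, F ((-R : ℝ) + t * I)) atTop
      (𝓝 (π * (lam : ℂ)⁻¹)) := by
    have hM : Tendsto (fun R : ℝ => mgf id ν (-R)) atTop (𝓝 0) :=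
      (tendsto_mgf_id_atBot hν).comp tendsto_neg_atTop_atBot
    refine tendsto_intervalIntegral_of_norm_sub_le
      (b := fun R => mgf id ν (-R) * (2 / lam ^ 2)) pi_pos.le (fun R => hvert (-R)) ?_
      (by simpa using hM.mul_const (2 / lam ^ 2))
    filter_upwards [hM.eventually_le_const (half_pos hlam)] with R hR t ht
    set z : ℂ := (-R : ℝ) + t * I
    have hz : z.im ∈ Icc 0 π := by simpa [z] using ht
    have hL : ‖complexMGF id ν z‖ ≤ mgf id ν (-R) := by
      simpa [z] using norm_complexMGF_le_mgf (X := id) (μ := ν) (z := z)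
    have hlam' : (lam : ℂ) ≠ 0 := by exact_mod_cast hlam.ne'
    have hn : lam / 2 ≤ ‖(lam : ℂ) + complexMGF id ν z‖ := by
      have := norm_sub_le_norm_add (lam : ℂ) (complexMGF id ν z)
      rw [norm_real, Real.norm_of_nonneg hlam.le] at this
      linarith
    have hne := add_complexMGF_id_ne_zero hν hlam.le hz
    rw [hF]
    dsimp only
    rw [inv_sub_inv hne hlam', norm_div, norm_mul, norm_real, Real.norm_of_nonneg hlam.le,
      sub_add_cancel_left, norm_neg]
    calc ‖complexMGF id ν z‖ / (‖(lam : ℂ) + complexMGF id ν z‖ * lam)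
        ≤ mgf id ν (-R) / (lam / 2 * lam) := by
          gcongr
          exact mgf_nonneg
      _ = mgf id ν (-R) * (2 / lam ^ 2) := by field_simp
  have hrect (R : ℝ) : (∫ x in (-R)..R, -(F (x + π * I)).im) =
      (∫ t in (0:ℝ)..π, F ((-R : ℝ) + t * I)).re - (∫ t in (0:ℝ)..π, F (R + t * I)).re := by
    have h := integral_boundary_rect_eq_zero_of_differentiableOn F (-R : ℝ) (R + π * I)
      (hd.mono fun z hz => by simpa [uIcc_of_le pi_pos.le] using hz.2)
    have him := congrArg Complex.im h
    have hreal : (∫ x in (-R)..R, F x).im = 0 := by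
      have (x : ℝ) : F x = (((lam + mgf id ν x)⁻¹ : ℝ) : ℂ) := by
        simp [hF, complexMGF_ofReal]
      simp_rw [this]
      rw [intervalIntegral.integral_ofReal, ofReal_im]
    have htop : (∫ x in (-R)..R, F (x + π * I)).im = ∫ x in (-R)..R, (F (x + π * I)).im := by
      have := imCLM.intervalIntegral_comp_comm
        ((hhor (right_mem_Icc.2 pi_pos.le)).intervalIntegrable (μ := volume) (-R) R)
      exact this.symm
    simp only [add_re, ofReal_re, add_im, ofReal_im, mul_re, mul_im, I_re, I_im, mul_zero,
      mul_one, add_zero, zero_add, zero_mul, sub_self, sub_im, smul_eq_mul, one_mul,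
      ofReal_zero, zero_im] at him
    rw [intervalIntegral.integral_neg, ← htop]
    linarith
  have hlim := (continuous_re.tendsto _).comp hleft |>.sub ((continuous_re.tendsto _).comp hright)
  have hval : ((π : ℂ) * (lam : ℂ)⁻¹).re - ((π : ℂ) * 0).re = π / lam := by
    rw [← ofReal_inv, ← ofReal_mul, ofReal_re, mul_zero, zero_re, sub_zero, div_eq_mul_inv]
  rw [hval] at hlim
  exact hlim.congr fun R => (hrect R).symm

lemma integral_im_inv_add_complexMGF [NeZero ν] (hν : ∀ᵐ a ∂ν, a ∈ Ioo (0:ℝ) 1)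
    {lam : ℝ} (hlam : 0 < lam) :
    ∫ x : ℝ, -((lam : ℂ) + complexMGF id ν (x + π * I))⁻¹.im = π / lam := by
  have hlim := tendsto_integral_im_inv_add_complexMGF hν hlam
  set g : ℝ → ℝ := fun x => -((lam : ℂ) + complexMGF id ν (x + π * I))⁻¹.im
  have hg : Continuous g := by
    refine (continuous_im.comp (Continuous.inv₀ ?_ fun x => ?_)).neg
    · exact continuous_const.add
        ((differentiable_complexMGF_id hν).continuous.comp (by fun_prop))
    · exact add_complexMGF_id_ne_zero hν hlam.le (by simp [pi_pos.le])
  have hg0 (x : ℝ) : 0 ≤ g x := by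
    simp only [g, inv_im, neg_div, neg_neg, add_im, ofReal_im, zero_add, im_complexMGF_id hν]
    refine div_nonneg (integral_nonneg_of_ae ?_) (normSq_nonneg _)
    filter_upwards [hν] with a ha
    have h : 0 ≤ Real.sin (π * a) := Real.sin_nonneg_of_nonneg_of_le_pi
      (mul_nonneg pi_pos.le ha.1.le) (by nlinarith [pi_pos, ha.2])
    simpa using mul_nonneg (Real.exp_pos _).le h
  have hint : Integrable g := by
    refine integrable_of_intervalIntegral_norm_tendsto (π / lam) (a := fun R : ℝ => -R)
      (b := fun R : ℝ => R) (l := atTop) (fun R => ?_) tendsto_neg_atTop_atBot tendsto_id ?_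
    · exact (hg.integrableOn_Icc).mono_set Ioc_subset_Icc_self
    · simpa only [Real.norm_of_nonneg (hg0 _)] using hlim
  exact tendsto_nhds_unique
    (intervalIntegral_tendsto_integral hint tendsto_neg_atTop_atBot tendsto_id) hlim

lemma integral_Ioi_eq_integral_exp_mul (f : ℝ → ℝ) :
    ∫ r in Ioi (0:ℝ), f r = ∫ x : ℝ, rexp x * f (rexp x) := by
  have h := integral_image_eq_integral_abs_deriv_smul (f := rexp) (f' := rexp) MeasurableSet.univ
    (fun x _ => (Real.hasDerivAt_exp x).hasDerivWithinAt) Real.exp_injective.injOn f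
  simpa [Real.range_exp] using h

lemma integral_Ioi_inv_mul_eq_pi_div [NeZero ν] (hν : ∀ᵐ a ∂ν, a ∈ Ioo (0:ℝ) 1)
    {lam : ℝ} (hlam : 0 < lam) :
    ∫ r in Ioi (0:ℝ), (1 / r) * ((∫ a, r ^ a * Real.sin (π * a) ∂ν) /
      ((lam + ∫ a, r ^ a * Real.cos (π * a) ∂ν) ^ 2 + (∫ a, r ^ a * Real.sin (π * a) ∂ν) ^ 2)) =
      π / lam := by
  rw [integral_Ioi_eq_integral_exp_mul, ← integral_im_inv_add_complexMGF hν hlam]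
  refine integral_congr_ae (.of_forall fun x => ?_)
  simp only [inv_im, normSq_apply, add_im, add_re, ofReal_re, ofReal_im, im_complexMGF_id hν,
    re_complexMGF_id hν, ← Real.exp_mul]
  rw [← mul_assoc, mul_one_div_cancel (Real.exp_pos x).ne']
  simp [neg_div, sq]

end LaplaceTransform

/-- formula (f9): under (aa) and (f1), for every `λ > 0`,
`(λ/π) ∫₀^∞ (1/r) G(r) dr = 1`. -/
theorem integral_G_div_r_eq_one (μ : ℝ → ℝ) (lam : ℝ) (hlam : 0 < lam)
    (hmeas : Measurable μ)
    (hnn : ∀ α ∈ Icc (0:ℝ) 1, 0 ≤ μ α)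
    (hint : IntegrableOn μ (Ioo 0 1))
    (hpos : 0 < ∫ α in Ioo (0:ℝ) 1, μ α)
    (hf1 : IntegrableOn (fun α => μ α / α) (Ioo 0 1)) :
    (lam / π) * ∫ r in Ioi (0:ℝ), (1 / r) *
      ((∫ α in Ioo (0:ℝ) 1, r ^ α * Real.sin (π * α) * μ α) /
        ((lam + ∫ α in Ioo (0:ℝ) 1, r ^ α * Real.cos (π * α) * μ α) ^ 2 +
          (∫ α in Ioo (0:ℝ) 1, r ^ α * Real.sin (π * α) * μ α) ^ 2)) = 1 := by
  set ν : Measure ℝ := (volume.restrict (Ioo 0 1)).withDensity fun α => ENNReal.ofReal (μ α)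
    with hν_def
  have : IsFiniteMeasure ν := isFiniteMeasure_withDensity_ofReal hint.2
  have hν : ∀ᵐ a ∂ν, a ∈ Ioo (0:ℝ) 1 :=
    (withDensity_absolutelyContinuous _ _).ae_le (ae_restrict_mem measurableSet_Ioo)
  have hconv (f : ℝ → ℝ) : ∫ α in Ioo (0:ℝ) 1, f α * μ α = ∫ α, f α ∂ν := by
    rw [hν_def, integral_withDensity_eq_integral_toReal_smul hmeas.ennreal_ofReal
      (.of_forall fun _ => ENNReal.ofReal_lt_top)]
    refine setIntegral_congr_fun measurableSet_Ioo fun α hα => ?_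
    simp [ENNReal.toReal_ofReal (hnn α (Ioo_subset_Icc_self hα)), mul_comm]
  have : NeZero ν := ⟨fun h0 => by
    have h := hconv fun _ => 1
    simp only [one_mul, h0, integral_zero_measure] at h
    exact hpos.ne' h⟩
  simp only [hconv]
  rw [integral_Ioi_inv_mul_eq_pi_div hν hlam]
  field_simp
end

section
/- Let F : ℂ ∖ (−∞, 0] → ℂ satisfy: (1) F is analytic on ℂ ∖ (−∞, 0]; (2) for a.e. t > 0 the limits F^±(t) := lim_{φ→π^−} F(t e^{±iφ}) exist and F^+(t) is the complex conjugate of F^−(t); (3) for each 0 < η < π, |F(p)| → 0 as |p| → ∞ uniformly on |arg p| < π − η, and |p|·|F(p)| → 0 as |p| → 0 uniformly on |arg p| < π − η; (4) there exist ε₀ ∈ (0, π/2) and a function a : (0,∞) → [0,∞) with a(r)/(1+r) ∈ L¹(0,∞) such that |F(r e^{±iφ})| ≤ a(r) for all r > 0 and all φ ∈ (π − ε₀, π). Then for every p ∈ ℂ with Re p > 0, F(p) = ∫₀^∞ e^{−xp} f(x) dx, where f(x) = (1/π) ∫₀^∞ e^{−rx} Im(F^−(r)) dr. -/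
open MeasureTheory Set Real Filter

lemma one_add_norm_le_mul_norm_sub {p z : ℂ} (hp : 0 < p.re) (hz : z.re ≤ 0) :
    1 + ‖z‖ ≤ (1 + (1 + ‖p‖) / p.re) * ‖z - p‖ := by
  have hre : p.re ≤ ‖z - p‖ := by
    have := Complex.abs_re_le_norm (z - p)
    rw [Complex.sub_re, abs_le] at this
    linarith
  have htri : ‖z‖ ≤ ‖z - p‖ + ‖p‖ := by simpa using norm_add_le (z - p) p
  have hmul : 1 + ‖p‖ ≤ (1 + ‖p‖) / p.re * ‖z - p‖ := by
    rw [div_mul_eq_mul_div, le_div_iff₀ hp]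
    gcongr
  linarith

lemma dslope_mul_self_eq {F : ℂ → ℂ} {p z : ℂ} (h : z ≠ p) :
    dslope F p z * z = (F z - F p) * z / (z - p) := by
  rw [dslope_of_ne _ h, slope_def_field]
  ring

lemma exp_mem_slitPlane_of_abs_im_lt {w : ℂ} (hw : |w.im| < π) :
    Complex.exp w ∈ Complex.slitPlane := by
  rw [Complex.mem_slitPlane_iff_arg, ← Complex.log_im,
    Complex.log_exp (abs_lt.1 hw).1 (abs_lt.1 hw).2.le]
  exact ⟨(abs_lt.1 hw).2.ne, Complex.exp_ne_zero _⟩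

lemma abs_arg_exp {w : ℂ} (hw : |w.im| < π) : |(Complex.exp w).arg| = |w.im| := by
  rw [← Complex.log_im, Complex.log_exp (abs_lt.1 hw).1 (abs_lt.1 hw).2.le]

lemma norm_dslope_mul_add_le {F : ℂ → ℂ} {p z : ℂ} {ε : ℝ} (hε : 0 < ε) (hz0 : 0 < ‖z‖)
    (hF : ‖F z‖ ≤ ε / 4) (hz : 2 * ‖p‖ + 4 * ‖p‖ * ‖F p‖ / ε ≤ ‖z‖) :
    ‖dslope F p z * z + F p‖ ≤ ε := by
  have h0 : 0 ≤ 4 * ‖p‖ * ‖F p‖ / ε := by positivity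
  have hsub : ‖z‖ / 2 ≤ ‖z - p‖ := by
    have := norm_sub_norm_le z p
    linarith
  have hpos : 0 < ‖z - p‖ := by linarith
  have hne : z - p ≠ 0 := norm_pos_iff.1 hpos
  have hzp : 4 * ‖p‖ * ‖F p‖ ≤ ‖z‖ * ε := by
    rw [← div_le_iff₀ hε]
    linarith [norm_nonneg p]
  have heq : dslope F p z * z + F p = (F z * z - F p * p) / (z - p) := by
    rw [dslope_mul_self_eq (sub_ne_zero.1 hne)]
    field_simp
    ring
  rw [heq, norm_div, div_le_iff₀ hpos]
  calc ‖F z * z - F p * p‖ ≤ ‖F z‖ * ‖z‖ + ‖F p‖ * ‖p‖ := by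
        simpa only [norm_mul] using norm_sub_le (F z * z) (F p * p)
    _ ≤ ε / 4 * ‖z‖ + ‖F p‖ * ‖p‖ := by gcongr
    _ ≤ ε * (‖z‖ / 2) := by linarith
    _ ≤ ε * ‖z - p‖ := by gcongr

lemma norm_dslope_mul_le {F : ℂ → ℂ} {p z : ℂ} {ε : ℝ} (hε : 0 < ε) (hp : 0 < ‖p‖)
    (hF : ‖z‖ * ‖F z‖ ≤ ε * ‖p‖ / 4) (hz : ‖z‖ ≤ ‖p‖ / 2)
    (hFp : ‖z‖ * ‖F p‖ ≤ ε * ‖p‖ / 4) :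
    ‖dslope F p z * z‖ ≤ ε := by
  have hsub : ‖p‖ / 2 ≤ ‖z - p‖ := by
    have := norm_sub_norm_le p z
    rw [norm_sub_rev] at this
    linarith
  have hpos : 0 < ‖z - p‖ := by linarith
  have hne : z - p ≠ 0 := norm_pos_iff.1 hpos
  rw [dslope_mul_self_eq (sub_ne_zero.1 hne), norm_div, div_le_iff₀ hpos]
  calc ‖(F z - F p) * z‖ ≤ (‖F z‖ + ‖F p‖) * ‖z‖ := by
        rw [norm_mul]
        gcongr
        exact norm_sub_le _ _
    _ ≤ ε * (‖p‖ / 2) := by linarith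
    _ ≤ ε * ‖z - p‖ := by gcongr

lemma tendsto_intervalIntegral_vertical {G : ℂ → ℂ} {φ : ℝ} (hφ : 0 < φ) (c : ℂ) {l : Filter ℝ}
    (hG : ContinuousOn G {w : ℂ | |w.im| ≤ φ})
    (h : ∀ ε > 0, ∀ᶠ x : ℝ in l, ∀ y : ℝ, |y| ≤ φ → ‖G (x + y * Complex.I) - c‖ ≤ ε) :
    Tendsto (fun x : ℝ => ∫ y : ℝ in (-φ)..φ, G (x + y * Complex.I)) l
      (nhds (2 * φ * c)) := by
  rw [Metric.tendsto_nhds]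
  intro ε hε
  filter_upwards [h (ε / (4 * φ)) (by positivity)] with x hx
  have hint : IntervalIntegrable (fun y : ℝ => G (x + y * Complex.I)) volume (-φ) φ := by
    apply ContinuousOn.intervalIntegrable
    refine hG.comp (by fun_prop) ?_
    intro y hy
    rw [uIcc_of_le (by linarith)] at hy
    simpa [abs_le] using hy
  have hconst : (2 * φ * c : ℂ) = ∫ _ in (-φ)..φ, c := by
    rw [intervalIntegral.integral_const, Complex.real_smul]
    push_cast
    ring
  rw [hconst, dist_eq_norm, ← intervalIntegral.integral_sub hint intervalIntegrable_const]
  have hle := intervalIntegral.norm_integral_le_of_norm_le_const (a := -φ) (b := φ)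
    (f := fun y : ℝ => G (x + y * Complex.I) - c) (C := ε / (4 * φ)) (by
      intro y hy
      rw [uIoc_of_le (by linarith)] at hy
      exact hx y (abs_le.2 ⟨hy.1.le, hy.2⟩))
  refine hle.trans_lt ?_
  rw [show φ - -φ = 2 * φ by ring, abs_of_pos (by positivity), div_mul_eq_mul_div,
    div_lt_iff₀ (by positivity)]
  nlinarith [mul_pos hε hφ]

/-- The part of Cauchy's formula for the sector `|arg z| < φ` which survives when the radii of the
bounding arcs tend to `0` and `∞`, with the pole at `p` removed by a difference quotient. -/
lemma integral_sector_boundary {F : ℂ → ℂ} {p : ℂ} {φ : ℝ}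
    (hF : DifferentiableOn ℂ F Complex.slitPlane) (hp : 0 < p.re) (hφ : 0 < φ) (hφπ : φ < π)
    (hinf : ∀ ε > 0, ∃ R > 0, ∀ z : ℂ, |z.arg| ≤ φ → R ≤ ‖z‖ → ‖F z‖ ≤ ε)
    (hzero : ∀ ε > 0, ∃ ρ > 0, ∀ z : ℂ, |z.arg| ≤ φ → 0 < ‖z‖ → ‖z‖ ≤ ρ → ‖z‖ * ‖F z‖ ≤ ε)
    {H : ℝ → ℂ}
    (hH : ∀ r : ℝ, H r =
      dslope F p (r * Complex.exp (-(φ : ℂ) * Complex.I)) * Complex.exp (-(φ : ℂ) * Complex.I) -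
      dslope F p (r * Complex.exp ((φ : ℂ) * Complex.I)) * Complex.exp ((φ : ℂ) * Complex.I))
    (hint : IntegrableOn H (Ioi 0)) :
    ∫ r in Ioi (0 : ℝ), H r = 2 * φ * Complex.I * F p := by
  have hp0 : 0 < ‖p‖ := hp.trans_le ((le_abs_self _).trans (Complex.abs_re_le_norm p))
  set G : ℂ → ℂ := fun w => dslope F p (Complex.exp w) * Complex.exp w with hGdef
  have hG : DifferentiableOn ℂ G {w : ℂ | |w.im| ≤ φ} := by
    have hd : DifferentiableOn ℂ (dslope F p) Complex.slitPlane :=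
      (Complex.differentiableOn_dslope (Complex.isOpen_slitPlane.mem_nhds (Or.inl hp))).2 hF
    refine DifferentiableOn.mul (hd.comp (by fun_prop) ?_) (by fun_prop)
    intro w hw
    exact exp_mem_slitPlane_of_abs_im_lt (lt_of_le_of_lt hw hφπ)
  have harg : ∀ x y : ℝ, |y| ≤ φ → |(Complex.exp (x + y * Complex.I)).arg| ≤ φ := by
    intro x y hy
    rw [abs_arg_exp] <;> simp <;> linarith
  have hnorm : ∀ x y : ℝ, ‖Complex.exp (x + y * Complex.I)‖ = Real.exp x := by
    intro x y
    simp [Complex.norm_exp]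
  have hright : Tendsto (fun x : ℝ => ∫ y : ℝ in (-φ)..φ, G (x + y * Complex.I)) atTop
      (nhds (2 * φ * (-F p))) := by
    refine tendsto_intervalIntegral_vertical hφ _ hG.continuousOn fun ε hε => ?_
    obtain ⟨R, -, hR⟩ := hinf (ε / 4) (by positivity)
    filter_upwards [tendsto_exp_atTop.eventually_ge_atTop R,
      tendsto_exp_atTop.eventually_ge_atTop (2 * ‖p‖ + 4 * ‖p‖ * ‖F p‖ / ε)] with x h1 h2 y hy
    rw [sub_neg_eq_add]
    exact norm_dslope_mul_add_le hε (by rw [hnorm]; positivity)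
      (hR _ (harg x y hy) (by rwa [hnorm])) (by rwa [hnorm])
  have hleft : Tendsto (fun x : ℝ => ∫ y : ℝ in (-φ)..φ, G (x + y * Complex.I)) atBot
      (nhds (2 * φ * 0)) := by
    refine tendsto_intervalIntegral_vertical hφ _ hG.continuousOn fun ε hε => ?_
    obtain ⟨ρ, hρ0, hρ⟩ := hzero (ε * ‖p‖ / 4) (by positivity)
    have hsmall : ∀ δ > 0, ∀ᶠ x : ℝ in atBot, Real.exp x < δ := fun δ hδ =>
      tendsto_exp_atBot.eventually_lt_const hδ
    filter_upwards [hsmall ρ hρ0, hsmall (‖p‖ / 2) (by positivity),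
      hsmall (ε * ‖p‖ / 4 / (‖F p‖ + 1)) (by positivity)] with x h1 h2 h3 y hy
    rw [sub_zero]
    refine norm_dslope_mul_le hε hp0 (hρ _ (harg x y hy) (by rw [hnorm]; positivity)
      (by rw [hnorm]; exact h1.le)) (by rw [hnorm]; exact h2.le) ?_
    rw [hnorm]
    rw [lt_div_iff₀ (by positivity)] at h3
    linarith [Real.exp_pos x]
  have himage : Real.exp '' univ = Ioi 0 := by rw [image_univ, Real.range_exp]
  have hderiv : ∀ x ∈ (univ : Set ℝ), HasDerivWithinAt Real.exp (Real.exp x) univ x :=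
    fun x _ => (Real.hasDerivAt_exp x).hasDerivWithinAt
  have hintexp : Integrable fun x : ℝ => |Real.exp x| • H (Real.exp x) := by
    rw [← integrableOn_univ]
    rw [← himage] at hint
    exact (integrableOn_image_iff_integrableOn_abs_deriv_smul MeasurableSet.univ hderiv
      Real.exp_injective.injOn H).1 hint
  have hchange : ∫ r in Ioi (0 : ℝ), H r = ∫ x : ℝ, |Real.exp x| • H (Real.exp x) := by
    rw [← himage, integral_image_eq_integral_abs_deriv_smul MeasurableSet.univ hderiv
      Real.exp_injective.injOn H, setIntegral_univ]
  have hlim := intervalIntegral_tendsto_integral hintexp tendsto_neg_atTop_atBot tendsto_id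
  have hrect : ∀ x : ℝ, (∫ s in (-x)..x, |Real.exp s| • H (Real.exp s)) =
      Complex.I • (∫ y : ℝ in (-φ)..φ, G ((-x : ℝ) + y * Complex.I)) -
      Complex.I • (∫ y : ℝ in (-φ)..φ, G (x + y * Complex.I)) := by
    intro x
    have hrect0 := Complex.integral_boundary_rect_eq_zero_of_differentiableOn G
      ⟨-x, -φ⟩ ⟨x, φ⟩ (hG.mono (by
        intro w hw
        have := hw.2
        rw [mem_preimage, uIcc_of_le (by simp only []; linarith)] at this
        exact abs_le.2 this))
    simp only [] at hrect0
    have hcont : ∀ θ : ℝ, |θ| ≤ φ →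
        IntervalIntegrable (fun s : ℝ => G (s + θ * Complex.I)) volume (-x) x := by
      intro θ hθ
      apply Continuous.intervalIntegrable
      refine hG.continuousOn.comp_continuous (by fun_prop) ?_
      intro s
      simpa using hθ
    rw [← intervalIntegral.integral_sub (hcont _ (by rw [abs_neg, abs_of_pos hφ]))
      (hcont _ (by rw [abs_of_pos hφ]))] at hrect0
    rw [← sub_eq_zero, ← hrect0]
    have : ∀ s : ℝ, |Real.exp s| • H (Real.exp s) =
        G (s + (-φ : ℝ) * Complex.I) - G (s + φ * Complex.I) := by
      intro s
      simp only [hGdef, hH, abs_of_pos (Real.exp_pos s), Complex.real_smul, Complex.ofReal_neg,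
        Complex.exp_add, ← Complex.ofReal_exp]
      ring
    simp only [this]
    ring
  have hlim2 := ((hleft.comp tendsto_neg_atTop_atBot).const_smul Complex.I).sub
    (hright.const_smul Complex.I)
  rw [hchange]
  refine (tendsto_nhds_unique hlim (hlim2.congr fun x => ?_)).trans ?_
  · exact (hrect x).symm
  · simp only [smul_eq_mul]
    ring

lemma laplace_laplace_eq_stieltjes {S : ℝ → ℝ} {p : ℂ} (hp : 0 < p.re)
    (hS : AEStronglyMeasurable S (volume.restrict (Ioi 0)))
    (hint : IntegrableOn (fun r => S r / (1 + r)) (Ioi 0)) :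
    ∫ x in Ioi (0 : ℝ), Complex.exp (-(x : ℂ) * p) *
        (((1 / π) * ∫ r in Ioi (0 : ℝ), Real.exp (-r * x) * S r : ℝ) : ℂ) =
      (1 / π : ℂ) * ∫ r in Ioi (0 : ℝ), (S r : ℂ) / (r + p) := by
  have hre : ∀ r : ℝ, 0 < r → (-(r + p)).re < 0 := by
    intro r hr
    simp only [Complex.neg_re, Complex.add_re, Complex.ofReal_re]
    linarith
  have hprod : Integrable (Function.uncurry fun x r : ℝ =>
      Complex.exp (-(r + p) * x) * (S r : ℂ))
      ((volume.restrict (Ioi 0)).prod (volume.restrict (Ioi 0))) := by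
    have hmeas : AEStronglyMeasurable (Function.uncurry fun x r : ℝ =>
        Complex.exp (-(r + p) * x) * (S r : ℂ))
        ((volume.restrict (Ioi 0)).prod (volume.restrict (Ioi 0))) := by
      refine AEStronglyMeasurable.mul (Continuous.aestronglyMeasurable (by fun_prop)) ?_
      exact (Complex.continuous_ofReal.comp_aestronglyMeasurable hS).comp_snd
    rw [integrable_prod_iff' hmeas]
    constructor
    · filter_upwards [ae_restrict_mem measurableSet_Ioi] with r hr
      exact (integrableOn_exp_mul_complex_Ioi (hre r hr) 0).mul_const (S r : ℂ)
    · refine Integrable.mono' (hint.norm.const_mul (1 + 1 / p.re))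
        (hmeas.norm.prod_swap.integral_prod_right') ?_
      filter_upwards [ae_restrict_mem measurableSet_Ioi] with r hr
      have hr0 : (0 : ℝ) < r := hr
      have hval : ∫ x in Ioi (0 : ℝ), ‖Complex.exp (-(r + p) * x) * (S r : ℂ)‖ =
          |S r| / (r + p.re) := by
        simp only [norm_mul, Complex.norm_exp, Complex.norm_real, Real.norm_eq_abs]
        rw [integral_mul_const]
        have := integral_exp_mul_Ioi (a := -(r + p.re)) (by linarith) 0
        simp only [Complex.mul_re, Complex.neg_re, Complex.add_re, Complex.ofReal_re,
          Complex.ofReal_im, mul_zero, sub_zero]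
        rw [this]
        simp only [mul_zero, Real.exp_zero]
        rw [neg_div_neg_eq]
        ring
      simp only [Function.uncurry_apply_pair]
      rw [hval, Real.norm_of_nonneg (by positivity), norm_div, Real.norm_eq_abs,
        Real.norm_of_nonneg (by positivity : 0 ≤ 1 + r), mul_div_assoc',
        div_le_div_iff₀ (by positivity) (by positivity)]
      have h1 : 1 + r ≤ (1 + 1 / p.re) * (r + p.re) := by
        have : (1 + 1 / p.re) * (r + p.re) = 1 + r + p.re + r / p.re := by field_simp; ring
        rw [this]
        have : 0 < r / p.re := by positivity
        linarith
      nlinarith [mul_le_mul_of_nonneg_left h1 (abs_nonneg (S r))]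
  calc ∫ x in Ioi (0 : ℝ), Complex.exp (-(x : ℂ) * p) *
        (((1 / π) * ∫ r in Ioi (0 : ℝ), Real.exp (-r * x) * S r : ℝ) : ℂ)
      = ∫ x in Ioi (0 : ℝ), (1 / π : ℂ) *
          ∫ r in Ioi (0 : ℝ), Complex.exp (-(r + p) * x) * (S r : ℂ) := by
        congr 1 with x
        rw [Complex.ofReal_mul, ← integral_complex_ofReal, mul_left_comm]
        push_cast
        rw [← integral_const_mul]
        congr 2 with r
        rw [← mul_assoc, ← Complex.exp_add]
        ring_nf
    _ = (1 / π : ℂ) * ∫ r in Ioi (0 : ℝ), (S r : ℂ) / (r + p) := by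
        rw [integral_const_mul, integral_integral_swap hprod]
        congr 1
        refine setIntegral_congr_fun measurableSet_Ioi fun r hr => ?_
        rw [integral_mul_const, integral_exp_mul_complex_Ioi (hre r hr)]
        simp only [Complex.ofReal_zero, mul_zero, Complex.exp_zero]
        rw [neg_div_neg_eq]
        ring

lemma norm_dslope_sub_le {F : ℂ → ℂ} {p u v : ℂ} {r A : ℝ} (hp : 0 < p.re) (hr : 0 < r)
    (hu : ‖u‖ = 1) (hv : ‖v‖ = 1) (hu0 : u.re ≤ 0) (hv0 : v.re ≤ 0)
    (hFu : ‖F (r * u)‖ ≤ A) (hFv : ‖F (r * v)‖ ≤ A) :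
    ‖dslope F p (r * u) * u - dslope F p (r * v) * v‖ ≤
      2 * (1 + (1 + ‖p‖) / p.re) * (A / (1 + r)) +
      2 * ‖F p‖ * ‖p‖ * (1 + (1 + ‖p‖) / p.re) ^ 2 * (1 + r ^ 2)⁻¹ := by
  set C := 1 + (1 + ‖p‖) / p.re with hC
  have hC0 : 0 < C := by positivity
  have hA : 0 ≤ A := (norm_nonneg _).trans hFu
  have hlow : ∀ w : ℂ, ‖w‖ = 1 → w.re ≤ 0 → (r * w - p ≠ 0 ∧ ‖r * w - p‖⁻¹ ≤ C / (1 + r)) := by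
    intro w hw hw0
    have h := one_add_norm_le_mul_norm_sub (z := r * w) hp
      (by simpa using mul_nonpos_of_nonneg_of_nonpos hr.le hw0)
    rw [norm_mul, hw, Complex.norm_real, Real.norm_of_nonneg hr.le, mul_one] at h
    have hpos : 0 < ‖r * w - p‖ := by
      by_contra hcon
      have : ‖r * w - p‖ = 0 := le_antisymm (not_lt.1 hcon) (norm_nonneg _)
      rw [this] at h
      linarith
    refine ⟨norm_pos_iff.1 hpos, ?_⟩
    rw [inv_le_comm₀ hpos (by positivity), inv_div, div_le_iff₀ hC0]
    linarith
  obtain ⟨hune, hub⟩ := hlow u hu hu0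
  obtain ⟨hvne, hvb⟩ := hlow v hv hv0
  have heq : dslope F p (r * u) * u - dslope F p (r * v) * v =
      F (r * u) * u * (r * u - p)⁻¹ - F (r * v) * v * (r * v - p)⁻¹ +
      F p * p * (u - v) * (r * u - p)⁻¹ * (r * v - p)⁻¹ := by
    rw [dslope_of_ne _ (sub_ne_zero.1 hune), dslope_of_ne _ (sub_ne_zero.1 hvne),
      slope_def_field, slope_def_field]
    field_simp
    ring
  have hterm : ∀ w : ℂ, ‖w‖ = 1 → ‖F (r * w)‖ ≤ A → ‖r * w - p‖⁻¹ ≤ C / (1 + r) →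
      ‖F (r * w) * w * (r * w - p)⁻¹‖ ≤ A * (C / (1 + r)) := by
    intro w hw hFw hb
    rw [norm_mul, norm_mul, hw, mul_one, norm_inv]
    gcongr
  have huv : ‖u - v‖ ≤ 2 := by
    have := norm_sub_le u v
    linarith
  have hlast : ‖F p * p * (u - v) * (r * u - p)⁻¹ * (r * v - p)⁻¹‖ ≤
      ‖F p‖ * ‖p‖ * 2 * (C / (1 + r)) * (C / (1 + r)) := by
    simp only [norm_mul, norm_inv]
    gcongr
  have hsq : (C / (1 + r)) * (C / (1 + r)) ≤ C ^ 2 * (1 + r ^ 2)⁻¹ := by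
    rw [div_mul_div_comm, ← sq, ← sq, div_eq_mul_inv]
    gcongr
    nlinarith
  have hlast2 := mul_le_mul_of_nonneg_left hsq (by positivity : 0 ≤ ‖F p‖ * ‖p‖ * 2)
  rw [heq]
  calc _ ≤ _ := norm_add_le _ _
    _ ≤ (A * (C / (1 + r)) + A * (C / (1 + r))) +
        ‖F p‖ * ‖p‖ * 2 * (C / (1 + r)) * (C / (1 + r)) :=
      add_le_add ((norm_sub_le _ _).trans
        (add_le_add (hterm u hu hFu hub) (hterm v hv hFv hvb))) hlast
    _ ≤ _ := by
      have : 2 * C * (A / (1 + r)) = A * (C / (1 + r)) + A * (C / (1 + r)) := by ring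
      linarith

lemma ofReal_mul_exp_mem_slitPlane {r θ : ℝ} (hr : 0 < r) (hθ : |θ| < π) :
    (r : ℂ) * Complex.exp ((θ : ℂ) * Complex.I) ∈ Complex.slitPlane := by
  have := exp_mem_slitPlane_of_abs_im_lt (w := (Real.log r : ℂ) + θ * Complex.I) (by simpa)
  rwa [Complex.exp_add, ← Complex.ofReal_exp, Real.exp_log hr] at this

lemma continuousOn_comp_ray {g : ℂ → ℂ} (hg : ContinuousOn g Complex.slitPlane) {θ : ℝ}
    (hθ : |θ| < π) :
    ContinuousOn (fun r : ℝ => g (r * Complex.exp ((θ : ℂ) * Complex.I))) (Ioi 0) :=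
  hg.comp (by fun_prop) fun _ hr => ofReal_mul_exp_mem_slitPlane hr hθ

lemma exp_mul_I_re_nonpos {θ : ℝ} (h1 : π / 2 ≤ |θ|) (h2 : |θ| < π) :
    (Complex.exp ((θ : ℂ) * Complex.I)).re ≤ 0 := by
  rw [Complex.exp_ofReal_mul_I_re, ← Real.cos_abs]
  exact Real.cos_nonpos_of_pi_div_two_le_of_le h1 (by linarith [Real.pi_pos])

/-- Lemma `odwrotna`: inverse Laplace transform representation.
`Fm` plays the role of the boundary value `F⁻(t) = lim_{φ→π⁻} F(t e^{-iφ})`,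
and the second limit hypothesis says `F⁺ = conj F⁻`. -/
theorem inverse_laplace_representation (F : ℂ → ℂ) (Fm : ℝ → ℂ)
    (h1 : DifferentiableOn ℂ F {z : ℂ | ¬(z.im = 0 ∧ z.re ≤ 0)})
    (h2 : ∀ᵐ (t : ℝ) ∂(volume.restrict (Ioi (0:ℝ))),
      Tendsto (fun φ : ℝ => F ((t : ℂ) * Complex.exp (-(φ : ℂ) * Complex.I)))
        (nhdsWithin π (Iio π)) (nhds (Fm t)) ∧
      Tendsto (fun φ : ℝ => F ((t : ℂ) * Complex.exp ((φ : ℂ) * Complex.I)))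
        (nhdsWithin π (Iio π)) (nhds (starRingEnd ℂ (Fm t))))
    (h3a : ∀ η ∈ Ioo (0:ℝ) π, ∀ ε > 0, ∃ R > 0, ∀ p : ℂ,
      |Complex.arg p| < π - η → R ≤ ‖p‖ → ‖F p‖ ≤ ε)
    (h3b : ∀ η ∈ Ioo (0:ℝ) π, ∀ ε > 0, ∃ ρ > 0, ∀ p : ℂ,
      |Complex.arg p| < π - η → 0 < ‖p‖ → ‖p‖ ≤ ρ → ‖p‖ * ‖F p‖ ≤ ε)
    (h4 : ∃ ε₀ ∈ Ioo (0:ℝ) (π / 2), ∃ a : ℝ → ℝ,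
      (∀ r, 0 ≤ a r) ∧
      IntegrableOn (fun r => a r / (1 + r)) (Ioi 0) ∧
      ∀ r > (0:ℝ), ∀ φ ∈ Ioo (π - ε₀) π,
        ‖F ((r : ℂ) * Complex.exp ((φ : ℂ) * Complex.I))‖ ≤ a r ∧
        ‖F ((r : ℂ) * Complex.exp (-(φ : ℂ) * Complex.I))‖ ≤ a r) :
    ∀ p : ℂ, 0 < p.re →
      F p = ∫ x in Ioi (0:ℝ), Complex.exp (-(x : ℂ) * p) *
        (((1 / π) * ∫ r in Ioi (0:ℝ), Real.exp (-r * x) * (Fm r).im : ℝ) : ℂ) := by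
  intro p hp
  obtain ⟨ε₀, ⟨hε₀, hε₀'⟩, a, -, haint, ha⟩ := h4
  have hslit : {z : ℂ | ¬(z.im = 0 ∧ z.re ≤ 0)} = Complex.slitPlane := by
    ext z
    rw [mem_ofPred_eq, Complex.mem_slitPlane_iff]
    by_cases h : z.im = 0 <;> simp [h]
  rw [hslit] at h1
  have hmem : ∀ᶠ φ : ℝ in nhdsWithin π (Iio π), φ ∈ Ioo (π - ε₀) π :=
    Ioo_mem_nhdsLT (by linarith)
  have hFm : AEStronglyMeasurable Fm (volume.restrict (Ioi 0)) := by
    obtain ⟨u, -, hu, hulim⟩ := exists_seq_strictMono_tendsto' (show (0 : ℝ) < π from Real.pi_pos)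
    have hu' : Tendsto u atTop (nhdsWithin π (Iio π)) :=
      tendsto_nhdsWithin_iff.2 ⟨hulim, Eventually.of_forall fun n => (hu n).2⟩
    refine aestronglyMeasurable_of_tendsto_ae atTop
      (f := fun n (t : ℝ) => F ((t : ℂ) * Complex.exp (-(u n : ℂ) * Complex.I)))
      (fun n => ?_) (h2.mono fun t ht => ht.1.comp hu')
    have := continuousOn_comp_ray h1.continuousOn (θ := -u n)
      (by rw [abs_neg, abs_of_pos (hu n).1]; exact (hu n).2)
    rw [Complex.ofReal_neg] at this
    exact this.aestronglyMeasurable measurableSet_Ioi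
  have hFm_le : ∀ᵐ r : ℝ ∂(volume.restrict (Ioi 0)), ‖Fm r‖ ≤ a r := by
    filter_upwards [h2, ae_restrict_mem measurableSet_Ioi] with r hr hr0
    exact le_of_tendsto hr.1.norm (hmem.mono fun φ hφ => (ha r hr0 φ hφ).2)
  have him : AEStronglyMeasurable (fun r => (Fm r).im) (volume.restrict (Ioi 0)) :=
    Complex.continuous_im.comp_aestronglyMeasurable hFm
  have himint : IntegrableOn (fun r => (Fm r).im / (1 + r)) (Ioi 0) := by
    refine Integrable.mono' haint
      (him.div₀ (by fun_prop : Continuous fun r : ℝ => 1 + r).aestronglyMeasurable) ?_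
    filter_upwards [hFm_le, ae_restrict_mem measurableSet_Ioi] with r hr hr0
    have hr0' : (0 : ℝ) < r := hr0
    rw [norm_div, Real.norm_eq_abs, Real.norm_of_nonneg (by positivity : 0 ≤ 1 + r)]
    gcongr
    exact (Complex.abs_im_le_norm _).trans hr
  rw [laplace_laplace_eq_stieltjes hp him himint]
  set H : ℝ → ℝ → ℂ := fun φ r =>
    dslope F p (r * Complex.exp (-(φ : ℂ) * Complex.I)) * Complex.exp (-(φ : ℂ) * Complex.I) -
    dslope F p (r * Complex.exp ((φ : ℂ) * Complex.I)) * Complex.exp ((φ : ℂ) * Complex.I)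
  set B : ℝ → ℝ := fun r =>
      2 * (1 + (1 + ‖p‖) / p.re) * (a r / (1 + r)) +
      2 * ‖F p‖ * ‖p‖ * (1 + (1 + ‖p‖) / p.re) ^ 2 * (1 + r ^ 2)⁻¹
  have hBint : IntegrableOn B (Ioi 0) :=
    (haint.const_mul _).add (integrable_inv_one_add_sq.integrableOn.const_mul _)
  have hd : ContinuousOn (dslope F p) Complex.slitPlane :=
    ((Complex.differentiableOn_dslope
      (Complex.isOpen_slitPlane.mem_nhds (Or.inl hp))).2 h1).continuousOn
  have hHmeas : ∀ φ ∈ Ioo (π - ε₀) π, AEStronglyMeasurable (H φ) (volume.restrict (Ioi 0)) := by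
    intro φ hφ
    have habs : |φ| < π := by
      rw [abs_of_pos (by linarith [hφ.1])]
      exact hφ.2
    have hneg := continuousOn_comp_ray hd (θ := -φ) (by rwa [abs_neg])
    rw [Complex.ofReal_neg] at hneg
    exact ((hneg.mul continuousOn_const).sub
      ((continuousOn_comp_ray hd habs).mul continuousOn_const)).aestronglyMeasurable
        measurableSet_Ioi
  have hHbound : ∀ φ ∈ Ioo (π - ε₀) π, ∀ᵐ r : ℝ ∂(volume.restrict (Ioi 0)),
      ‖H φ r‖ ≤ B r := by
    intro φ hφ
    have habs : |φ| = φ := abs_of_pos (by linarith [hφ.1])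
    filter_upwards [ae_restrict_mem measurableSet_Ioi] with r hr
    have hpos := exp_mul_I_re_nonpos (θ := φ) (by linarith [hφ.1]) (by linarith [hφ.2])
    have hneg := exp_mul_I_re_nonpos (θ := -φ) (by rw [abs_neg]; linarith [hφ.1])
      (by rw [abs_neg]; linarith [hφ.2])
    have hnormneg := Complex.norm_exp_ofReal_mul_I (-φ)
    rw [Complex.ofReal_neg] at hneg hnormneg
    exact norm_dslope_sub_le hp hr hnormneg (Complex.norm_exp_ofReal_mul_I φ) hneg hpos
      (ha r hr φ hφ).2 (ha r hr φ hφ).1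
  have hHint : ∀ φ ∈ Ioo (π - ε₀) π, ∫ r in Ioi (0 : ℝ), H φ r = 2 * φ * Complex.I * F p := by
    intro φ hφ
    have hη : (π - φ) / 2 ∈ Ioo 0 π := ⟨by linarith [hφ.2], by linarith [hφ.1, hφ.2]⟩
    have hlt : ∀ z : ℂ, |z.arg| ≤ φ → |z.arg| < π - (π - φ) / 2 := fun z hz => by
      linarith [hφ.2]
    refine integral_sector_boundary h1 hp (by linarith [hφ.1]) hφ.2 ?_ ?_ (fun r => rfl)
      (hBint.mono' (hHmeas φ hφ) (hHbound φ hφ))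
    · intro ε hε
      obtain ⟨R, hR, h⟩ := h3a _ hη ε hε
      exact ⟨R, hR, fun z hz => h z (hlt z hz)⟩
    · intro ε hε
      obtain ⟨ρ, hρ, h⟩ := h3b _ hη ε hε
      exact ⟨ρ, hρ, fun z hz => h z (hlt z hz)⟩
  have hHlim : ∀ᵐ r : ℝ ∂(volume.restrict (Ioi 0)),
      Tendsto (fun φ => H φ r) (nhdsWithin π (Iio π))
        (nhds (2 * Complex.I * ((Fm r).im / (r + p)))) := by
    filter_upwards [h2, ae_restrict_mem measurableSet_Ioi] with r hr hr0
    have hr0' : (0 : ℝ) < r := hr0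
    have hrp : (r : ℂ) + p ≠ 0 := by
      intro h
      have := congrArg Complex.re h
      simp at this
      linarith
    have hside : ∀ (e : ℝ → ℂ) (b : ℂ), Continuous e → e π = -1 →
        Tendsto (fun φ => F (r * e φ)) (nhdsWithin π (Iio π)) (nhds b) →
        Tendsto (fun φ => dslope F p (r * e φ) * e φ) (nhdsWithin π (Iio π))
          (nhds ((b - F p) / (r + p))) := by
      intro e b he heπ hb
      have hlim : Tendsto e (nhdsWithin π (Iio π)) (nhds (-1)) := by
        rw [← heπ]
        exact he.continuousAt.tendsto.mono_left nhdsWithin_le_nhds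
      have hden : Tendsto (fun φ => r * e φ - p) (nhdsWithin π (Iio π)) (nhds (r * -1 - p)) :=
        (hlim.const_mul _).sub_const _
      have hne : (r : ℂ) * -1 - p ≠ 0 := by
        intro h
        apply hrp
        linear_combination -h
      have := ((hb.sub_const (F p)).div hden hne).mul hlim
      have hval : (b - F p) / (r + p) = (b - F p) / (r * -1 - p) * -1 := by
        rw [show (r : ℂ) * -1 - p = -(r + p) by ring, div_neg]
        ring
      rw [hval]
      refine this.congr' ?_
      filter_upwards [hden.eventually_ne hne] with φ hφ
      rw [dslope_of_ne _ (sub_ne_zero.1 hφ), slope_def_field]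
      rfl
    have hsub := (hside (fun φ => Complex.exp (-(φ : ℂ) * Complex.I)) _ (by fun_prop)
      (by simp [Complex.exp_neg]) hr.1).sub
      (hside (fun φ => Complex.exp ((φ : ℂ) * Complex.I)) _ (by fun_prop) (by simp) hr.2)
    have hval : 2 * Complex.I * ((Fm r).im / (r + p)) =
        (Fm r - F p) / (r + p) - (starRingEnd ℂ (Fm r) - F p) / (r + p) := by
      rw [← sub_div, sub_sub_sub_cancel_right, Complex.sub_conj]
      push_cast
      ring
    rw [hval]
    exact hsub
  have hdct := tendsto_integral_filter_of_dominated_convergence B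
    (hmem.mono hHmeas) (hmem.mono hHbound) hBint hHlim
  have hlim : Tendsto (fun φ : ℝ => 2 * (φ : ℂ) * Complex.I * F p) (nhdsWithin π (Iio π))
      (nhds (2 * (π : ℂ) * Complex.I * F p)) :=
    (show Continuous fun φ : ℝ => 2 * (φ : ℂ) * Complex.I * F p by
      fun_prop).continuousAt.tendsto.mono_left nhdsWithin_le_nhds
  have hfinal := tendsto_nhds_unique (hdct.congr' (hmem.mono hHint)) hlim
  rw [integral_const_mul] at hfinal
  have hπ : (π : ℂ) ≠ 0 := Complex.ofReal_ne_zero.2 Real.pi_ne_zero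
  have hcancel := mul_left_cancel₀ (mul_ne_zero two_ne_zero Complex.I_ne_zero)
    (hfinal.trans (show _ = 2 * Complex.I * (π * F p) by ring))
  rw [hcancel]
  field_simp
end
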